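/- arXiv:2105.06273 — 2 statements merged into one kernel-verified Lean document; each statement's English description precedes it below -/
import Mathlib

section
/- Let A be an Artin algebra. The following statements are equivalent: (1) A has only trivial 0-Igusa-Todorov subcategories; (2) γ(M) ≥ 1 for every M ∈ mod A that is not projective; (3) γ(M) ≥ 1 for every indecomposable non-projective M ∈ mod A. -/
/-!
Common framework for formalizing "On Lat-Igusa-Todorov algebras" (Barrios–Mata).

For a ring `S`, `FGMod S` is the "category" of finitely generated (left) `S`-modules;
for an Artin algebra `A`, the category `mod A` of finitely generated *right*
`A`-modules is `FGMod Aᵐᵒᵖ`.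
-/

universe u v

open Function

namespace LIT

/-- The `η` invariant from Fitting's Lemma: for an endomorphism `L` of an abelian
group `G` and a subgroup `X`, the least `k` such that for all `m ≥ k` the
restriction of `L` to `L^m(X)` is a monomorphism `L^m(X) → L^{m+1}(X)`. -/
noncomputable def eta {G : Type v} [AddCommGroup G] (L : AddMonoid.End G)
    (X : AddSubgroup G) : ℕ :=
  sInf {k : ℕ | ∀ m : ℕ, k ≤ m → Set.InjOn L (X.map (L ^ m) : Set G)}

/-- Bundled finitely generated `S`-modules. -/
structure FGMod (S : Type u) [Ring S] : Type (u + 1) where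
  carrier : Type u
  [isAddCommGroup : AddCommGroup carrier]
  [isModule : Module S carrier]
  [isFinite : Module.Finite S carrier]

attribute [instance] FGMod.isAddCommGroup FGMod.isModule FGMod.isFinite

/-- The regular module `S` over itself. -/
def FGMod.regular (S : Type u) [Ring S] : FGMod S := ⟨S⟩

/-- A ring is finitely generated as a right module over itself. -/
instance (A : Type u) [Ring A] : Module.Finite Aᵐᵒᵖ A :=
  Module.Finite.of_surjective
    ({ toFun := MulOpposite.unop
       map_add' := fun _ _ => rfl
       map_smul' := fun _ _ => rfl } : Aᵐᵒᵖ →ₗ[Aᵐᵒᵖ] A)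
    (fun x => ⟨MulOpposite.op x, rfl⟩)

namespace FGMod

variable {S : Type u} [Ring S]

/-- Projectivity of a module. -/
def IsProj (M : FGMod S) : Prop := Module.Projective S M.carrier

/-- Direct sum (product) of two modules. -/
def prodMod (M N : FGMod S) : FGMod S := ⟨M.carrier × N.carrier⟩

/-- Finite direct sums. -/
def dsum {n : ℕ} (f : Fin n → FGMod S) : FGMod S := ⟨∀ i, (f i).carrier⟩

/-- `N` is a direct summand of `M`. -/
def IsSummand (N M : FGMod S) : Prop :=
  ∃ N' : FGMod S, Nonempty (M.carrier ≃ₗ[S] N.carrier × N'.carrier)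

/-- `addOf C` is `add C`: all direct summands of finite direct sums of modules of `C`. -/
def addOf (C : Set (FGMod S)) : Set (FGMod S) :=
  {N | ∃ (n : ℕ) (f : Fin n → FGMod S), (∀ i, f i ∈ C) ∧ IsSummand N (dsum f)}

/-- `f : P → M` is a projective cover: `P` projective, `f` surjective with superfluous kernel. -/
def IsProjCover {P M : FGMod S} (f : P.carrier →ₗ[S] M.carrier) : Prop :=
  P.IsProj ∧ Surjective f ∧
    ∀ N : Submodule S P.carrier, N ⊔ LinearMap.ker f = ⊤ → N = ⊤

/-- `N` is (isomorphic to) the syzygy `Ω(M)`, i.e. the kernel of a projective cover of `M`. -/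
def IsSyzygyOf (N M : FGMod S) : Prop :=
  ∃ (P : FGMod S) (f : P.carrier →ₗ[S] M.carrier),
    IsProjCover f ∧ Nonempty (N.carrier ≃ₗ[S] LinearMap.ker f)

/-- The syzygy `Ω(M)` of `M` (a choice of it; over an Artin algebra it exists and is
unique up to isomorphism). -/
noncomputable def syz (M : FGMod S) : FGMod S :=
  letI := Classical.propDecidable (∃ N, IsSyzygyOf N M)
  if h : ∃ N, IsSyzygyOf N M then h.choose else M

/-- `SES X Y Z` : there is a short exact sequence `0 → X → Y → Z → 0`. -/
def SES (X Y Z : FGMod S) : Prop :=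
  ∃ (f : X.carrier →ₗ[S] Y.carrier) (g : Y.carrier →ₗ[S] Z.carrier),
    Injective f ∧ Surjective g ∧ LinearMap.range f = LinearMap.ker g

/-- Projective dimension, via vanishing of syzygies. -/
noncomputable def pdim (M : FGMod S) : ℕ∞ :=
  sInf ((↑) '' {n : ℕ | (syz^[n] M).IsProj})

end FGMod

open FGMod

variable {S : Type u} [Ring S]

/-- The finitistic dimension of a class of modules: the supremum of the projective
dimensions of its modules of finite projective dimension. -/
noncomputable def findim (C : Set (FGMod S)) : ℕ∞ :=
  ⨆ M ∈ {M ∈ C | pdim M ≠ ⊤}, pdim M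

/-- The global dimension of a class of modules. -/
noncomputable def gldim (C : Set (FGMod S)) : ℕ∞ :=
  ⨆ M ∈ C, pdim M

/-- The defining relations of `K₀`: `[M] - [M'] - [M'']` for `M ≅ M' ⊕ M''`, and `[P]`
for `P` projective. -/
def K0Rels (S : Type u) [Ring S] : AddSubgroup (FreeAbelianGroup (FGMod S)) :=
  AddSubgroup.closure
    ({x | ∃ M M' M'' : FGMod S,
        Nonempty (M.carrier ≃ₗ[S] M'.carrier × M''.carrier) ∧
        x = FreeAbelianGroup.of M - FreeAbelianGroup.of M' - FreeAbelianGroup.of M''} ∪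
      {x | ∃ P : FGMod S, P.IsProj ∧ x = FreeAbelianGroup.of P})

/-- `K₀(A)`: the free abelian group on the modules modulo the relations above. -/
abbrev K0 (S : Type u) [Ring S] : Type (u + 1) :=
  FreeAbelianGroup (FGMod S) ⧸ K0Rels S

/-- The class `[M]` of a module in `K₀`. -/
def toK0 (M : FGMod S) : K0 S := QuotientAddGroup.mk (FreeAbelianGroup.of M)

/-- `⟨C⟩`: the subgroup of `K₀` generated by the classes of direct summands of
modules of `C`. -/
def grpOf (C : Set (FGMod S)) : AddSubgroup (K0 S) :=
  AddSubgroup.closure {x | ∃ N M : FGMod S, M ∈ C ∧ IsSummand N M ∧ x = toK0 N}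

/-- `K_D = K₀/⟨D⟩`. -/
abbrev KD (D : Set (FGMod S)) : Type (u + 1) := K0 S ⧸ grpOf D

/-- The class of a module in `K_D`. -/
def toKD (D : Set (FGMod S)) (M : FGMod S) : KD D :=
  QuotientAddGroup.mk (toK0 M)

/-- `L` is the endomorphism `Ω̄` of `K₀` induced by the syzygy operator (it is unique). -/
def IsSyzEnd (L : AddMonoid.End (K0 S)) : Prop :=
  ∀ M : FGMod S, L (toK0 M) = toK0 (syz M)

/-- `L` is the endomorphism `Ω̄_D` of `K_D` induced by the syzygy operator. -/
def IsSyzEndD (D : Set (FGMod S)) (L : AddMonoid.End (KD D)) : Prop :=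
  ∀ M : FGMod S, L (toKD D M) = toKD D (syz M)

/-- The Igusa–Todorov function `φ`, relative to the induced endomorphism `L = Ω̄` of `K₀`. -/
noncomputable def phi (L : AddMonoid.End (K0 S)) (M : FGMod S) : ℕ :=
  eta L (grpOf {M})

/-- `φ`-dimension of a class of modules. -/
noncomputable def phidim (L : AddMonoid.End (K0 S)) (C : Set (FGMod S)) : ℕ∞ :=
  ⨆ M ∈ C, (phi L M : ℕ∞)

/-- The generalized Igusa–Todorov function `φ_[D]`, relative to `L = Ω̄_D`. -/
noncomputable def phiD (D : Set (FGMod S)) (L : AddMonoid.End (KD D)) (M : FGMod S) : ℕ :=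
  eta L ((grpOf {M}).map (QuotientAddGroup.mk' (grpOf D)))

/-- The generalized Igusa–Todorov function `ψ_[D]`. -/
noncomputable def psiD (D : Set (FGMod S)) (L : AddMonoid.End (KD D)) (M : FGMod S) : ℕ∞ :=
  (phiD D L M : ℕ∞) + findim (addOf {syz^[phiD D L M] M})

/-- `D` is a `0`-Igusa–Todorov subcategory: `D = add D`, `Ω(D) ⊆ D` and `φdim D = 0`. -/
def IsZeroIT (L : AddMonoid.End (K0 S)) (D : Set (FGMod S)) : Prop :=
  D = addOf D ∧ (∀ M ∈ D, syz M ∈ D) ∧ phidim L D = 0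

/-- The class `C` is `(n,V,D)`-Lat-Igusa-Todorov: every `M ∈ C` admits an exact sequence
`0 → V₁ ⊕ D₁ → V₀ ⊕ D₀ → Ωⁿ(M) → 0` with `V₁, V₀ ∈ add V` and `D₁, D₀ ∈ D`. -/
def IsLITClass (n : ℕ) (V : FGMod S) (D : Set (FGMod S)) (C : Set (FGMod S)) : Prop :=
  ∀ M ∈ C, ∃ V1 V0 D1 D0 : FGMod S,
    V1 ∈ addOf {V} ∧ V0 ∈ addOf {V} ∧ D1 ∈ D ∧ D0 ∈ D ∧
    SES (prodMod V1 D1) (prodMod V0 D0) (syz^[n] M)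

/-- `[C]_D`: the image of `⟨C⟩` in `K_D`, i.e. `(⟨C⟩ + ⟨D⟩)/⟨D⟩`. -/
def classGrpD (D C : Set (FGMod S)) : AddSubgroup (KD D) :=
  (grpOf C).map (QuotientAddGroup.mk' (grpOf D))

/-- `C` is `D`-syzygy finite: `[Ω^k(C)]_D` is finitely generated for some `k`. -/
def DSyzFinite (D C : Set (FGMod S)) : Prop :=
  ∃ k : ℕ, (classGrpD D ((fun M => syz^[k] M) '' C)).FG

/-- The algebra is `n`-LIT: there are a `0`-Igusa–Todorov subcategory `D` and a module `V`
such that `mod A` is `(n,V,D)`-LIT. -/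
def IsNLITAlgebra (L : AddMonoid.End (K0 S)) (n : ℕ) : Prop :=
  ∃ (V : FGMod S) (D : Set (FGMod S)), IsZeroIT L D ∧ IsLITClass n V D Set.univ

/-- The algebra is LIT: it is `n`-LIT for some `n`. -/
def IsLITAlgebra (L : AddMonoid.End (K0 S)) : Prop :=
  ∃ n : ℕ, IsNLITAlgebra L n


/-! Indecomposable modules, finiteness up to isomorphism, and modules over quotient
algebras viewed inside `mod A`. -/

/-- `M` is indecomposable: nonzero, and any direct sum decomposition is trivial. -/
def Indec {S : Type u} [Ring S] (M : FGMod S) : Prop :=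
  ¬ Subsingleton M.carrier ∧
    ∀ N N' : FGMod S, Nonempty (M.carrier ≃ₗ[S] N.carrier × N'.carrier) →
      Subsingleton N.carrier ∨ Subsingleton N'.carrier

/-- A class of modules contains only finitely many isomorphism classes. -/
def FinUpToIso {S : Type u} [Ring S] (C : Set (FGMod S)) : Prop :=
  ∃ (n : ℕ) (f : Fin n → FGMod S),
    ∀ M ∈ C, ∃ i, Nonempty (M.carrier ≃ₗ[S] (f i).carrier)

/-- The right `A`-modules annihilated by a (two-sided) ideal `I`, i.e. the image of
`mod (A/I)` inside `mod A`. -/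
def annClass {A : Type u} [Ring A] (I : Submodule Aᵐᵒᵖ A) : Set (FGMod Aᵐᵒᵖ) :=
  {M | ∀ (m : M.carrier), ∀ a ∈ I, MulOpposite.op a • m = 0}

/-- The right `A`-module `A/I`. -/
def qmod {A : Type u} [Ring A] (I : Submodule Aᵐᵒᵖ A) : FGMod Aᵐᵒᵖ := ⟨A ⧸ I⟩

/-- `γ(M) = φdim(add {N | N is a direct summand of Ωⁿ(M) for some n})`. -/
noncomputable def gamma {S : Type u} [Ring S] (L : AddMonoid.End (K0 S))
    (M : FGMod S) : ℕ∞ :=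
  phidim L (addOf {N : FGMod S | ∃ n : ℕ, IsSummand N (syz^[n] M)})

/-- A submodule is superfluous if it has no proper supplement. -/
def IsSuperfluous {P : Type*} [AddCommGroup P] [Module S P] (K : Submodule S P) : Prop :=
  ∀ N : Submodule S P, N ⊔ K = ⊤ → N = ⊤

namespace IsSuperfluous

variable {P Q : Type*} [AddCommGroup P] [Module S P] [AddCommGroup Q] [Module S Q]

theorem bot : IsSuperfluous (⊥ : Submodule S P) := fun N h => by simpa using h

theorem sup {K K' : Submodule S P} (hK : IsSuperfluous K) (hK' : IsSuperfluous K') :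
    IsSuperfluous (K ⊔ K') := fun N h => hK N (hK' _ (by rwa [sup_assoc]))

theorem finset_sup {ι : Type*} (s : Finset ι) {K : ι → Submodule S P}
    (hK : ∀ i, IsSuperfluous (K i)) : IsSuperfluous (s.sup K) :=
  Finset.sup_induction bot (fun _ h _ h' => h.sup h') fun i _ => hK i

theorem iSup {ι : Type*} [Finite ι] {K : ι → Submodule S P}
    (hK : ∀ i, IsSuperfluous (K i)) : IsSuperfluous (⨆ i, K i) := by
  cases nonempty_fintype ι
  rw [← Finset.sup_univ_eq_iSup]
  exact finset_sup _ hK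

theorem map {K : Submodule S P} (hK : IsSuperfluous K) (g : P →ₗ[S] Q) :
    IsSuperfluous (K.map g) := by
  intro N h
  have hcomap : N.comap g = ⊤ := by
    refine hK _ (eq_top_iff.2 fun p _ => ?_)
    obtain ⟨n, hn, _, ⟨k, hk, rfl⟩, hnk⟩ :=
      Submodule.mem_sup.1 (h ▸ Submodule.mem_top : g p ∈ N ⊔ K.map g)
    refine Submodule.mem_sup.2 ⟨p - k, ?_, k, hk, sub_add_cancel p k⟩
    rw [Submodule.mem_comap, map_sub, ← hnk, add_sub_cancel_right]
    exact hn
  have hle : K.map g ≤ N :=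
    Submodule.map_le_iff_le_comap.2 (hcomap ▸ le_top)
  rwa [sup_eq_left.2 hle] at h

end IsSuperfluous

namespace FGMod

theorem IsProjCover.surjective_of_comp {P P' M M' : FGMod S} {f : P.carrier →ₗ[S] M.carrier}
    {f' : P'.carrier →ₗ[S] M'.carrier} (hf : IsProjCover f) (hf' : IsProjCover f')
    (e : M.carrier ≃ₗ[S] M'.carrier) {g : P.carrier →ₗ[S] P'.carrier}
    (hg : f' ∘ₗ g = e.toLinearMap ∘ₗ f) : Surjective g := by
  refine LinearMap.range_eq_top.1 (hf'.2.2 _ (eq_top_iff.2 fun q _ => ?_))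
  obtain ⟨p, hp⟩ := hf.2.1 (e.symm (f' q))
  have hpq : f' (g p) = f' q := by
    simpa [hp] using LinearMap.congr_fun hg p
  exact Submodule.mem_sup.2 ⟨g p, ⟨p, rfl⟩, q - g p, by simp [hpq], by abel⟩

theorem IsProjCover.exists_lift {P P' M M' : FGMod S} {f : P.carrier →ₗ[S] M.carrier}
    {f' : P'.carrier →ₗ[S] M'.carrier} (hf : IsProjCover f) (hf' : IsProjCover f')
    (e : M.carrier ≃ₗ[S] M'.carrier) :
    ∃ g : P.carrier →ₗ[S] P'.carrier, f' ∘ₗ g = e.toLinearMap ∘ₗ f := by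
  have : Module.Projective S P.carrier := hf.1
  exact Module.projective_lifting_property f' _ hf'.2.1

/-- Syzygies of isomorphic modules are isomorphic. -/
theorem IsSyzygyOf.nonempty_equiv [IsNoetherianRing S] {N N' M M' : FGMod S}
    (h : IsSyzygyOf N M) (h' : IsSyzygyOf N' M') (e : M.carrier ≃ₗ[S] M'.carrier) :
    Nonempty (N.carrier ≃ₗ[S] N'.carrier) := by
  obtain ⟨P, f, hf, ⟨i⟩⟩ := h
  obtain ⟨P', f', hf', ⟨i'⟩⟩ := h'
  obtain ⟨g, hg⟩ := hf.exists_lift hf' e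
  obtain ⟨g', hg'⟩ := hf'.exists_lift hf e.symm
  have hgs := hf.surjective_of_comp hf' e hg
  have hgs' := hf'.surjective_of_comp hf e.symm hg'
  have hinj : Injective (g' ∘ₗ g) :=
    IsNoetherian.injective_of_surjective_endomorphism _ (hgs'.comp hgs)
  have hgi : Injective g := Injective.of_comp (f := g') hinj
  let G : P.carrier ≃ₗ[S] P'.carrier := LinearEquiv.ofBijective g ⟨hgi, hgs⟩
  have hker : (LinearMap.ker f).map (G : P.carrier →ₗ[S] P'.carrier) = LinearMap.ker f' := by
    ext q
    obtain ⟨p, rfl⟩ := hgs q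
    have hp : f' (g p) = e (f p) := LinearMap.congr_fun hg p
    constructor
    · rintro ⟨p', hp', hpp'⟩
      obtain rfl : p' = p := hgi hpp'
      simpa [hp] using hp'
    · intro hq
      exact ⟨p, by simpa [hp] using hq, rfl⟩
  exact ⟨i.trans ((G.ofSubmodules _ _ hker).trans i'.symm)⟩

theorem IsProjCover.prodMap {P P' M M' : FGMod S} {f : P.carrier →ₗ[S] M.carrier}
    {f' : P'.carrier →ₗ[S] M'.carrier} (hf : IsProjCover f) (hf' : IsProjCover f') :
    IsProjCover (P := prodMod P P') (M := prodMod M M') (f.prodMap f') := by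
  have : Module.Projective S P.carrier := hf.1
  have : Module.Projective S P'.carrier := hf'.1
  refine ⟨inferInstanceAs (Module.Projective S (P.carrier × P'.carrier)),
    hf.2.1.prodMap hf'.2.1, ?_⟩
  have hsup := (IsSuperfluous.map hf.2.2 (LinearMap.inl S P.carrier P'.carrier)).sup
    (IsSuperfluous.map hf'.2.2 (LinearMap.inr S P.carrier P'.carrier))
  have hker : LinearMap.ker (f.prodMap f') =
      (LinearMap.ker f).map (LinearMap.inl S P.carrier P'.carrier) ⊔
        (LinearMap.ker f').map (LinearMap.inr S P.carrier P'.carrier) := by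
    rw [LinearMap.ker_prodMap]
    exact (LinearMap.prod_eq_sup_map _ _)
  intro N hN
  exact hsup N (hker ▸ hN)

theorem IsProjCover.piMap {n : ℕ} {P M : Fin n → FGMod S}
    {f : ∀ i, (P i).carrier →ₗ[S] (M i).carrier} (hf : ∀ i, IsProjCover (f i)) :
    IsProjCover (P := dsum P) (M := dsum M) (LinearMap.piMap f) := by
  have (i : Fin n) : Module.Projective S (P i).carrier := (hf i).1
  refine ⟨Module.Projective.of_equiv
    (DFinsupp.linearEquivFunOnFintype (R := S) (M := fun i => (P i).carrier)),
    Surjective.piMap fun i => (hf i).2.1, ?_⟩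
  have hsup := IsSuperfluous.iSup fun i =>
    IsSuperfluous.map (hf i).2.2 (LinearMap.single S (fun i => (P i).carrier) i)
  have hker : LinearMap.ker (LinearMap.piMap f) =
      ⨆ i, (LinearMap.ker (f i)).map (LinearMap.single S (fun i => (P i).carrier) i) := by
    rw [Submodule.iSup_map_single]
    ext x
    simp [funext_iff, Submodule.mem_pi]
  intro N hN
  exact hsup N (hker ▸ hN)

theorem IsSyzygyOf.prodMod {N N' M M' : FGMod S} (h : IsSyzygyOf N M) (h' : IsSyzygyOf N' M') :
    IsSyzygyOf (prodMod N N') (prodMod M M') := by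
  obtain ⟨P, f, hf, ⟨i⟩⟩ := h
  obtain ⟨P', f', hf', ⟨i'⟩⟩ := h'
  let k : (LinearMap.ker f × LinearMap.ker f') ≃ₗ[S] LinearMap.ker (f.prodMap f') := {
    toFun := fun x => ⟨(x.1, x.2), Prod.ext x.1.2 x.2.2⟩
    invFun := fun x => (⟨x.1.1, congrArg Prod.fst x.2⟩, ⟨x.1.2, congrArg Prod.snd x.2⟩)
    map_add' := fun _ _ => rfl
    map_smul' := fun _ _ => rfl }
  exact ⟨_, _, hf.prodMap hf', ⟨(i.prodCongr i').trans k⟩⟩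

theorem IsSyzygyOf.dsum {n : ℕ} {N M : Fin n → FGMod S} (h : ∀ i, IsSyzygyOf (N i) (M i)) :
    IsSyzygyOf (dsum N) (dsum M) := by
  choose P f hf e using h
  let k : (∀ i, LinearMap.ker (f i)) ≃ₗ[S] LinearMap.ker (LinearMap.piMap f) := {
    toFun := fun x => ⟨fun i => x i, funext fun i => (x i).2⟩
    invFun := fun x i => ⟨x.1 i, congrFun x.2 i⟩
    map_add' := fun _ _ => rfl
    map_smul' := fun _ _ => rfl }
  exact ⟨_, _, IsProjCover.piMap hf, ⟨(LinearEquiv.piCongrRight fun i => (e i).some).trans k⟩⟩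

/-- Every surjection from a projective module onto `M` which does not have superfluous kernel
can be replaced by one from a projective module of smaller length. -/
theorem exists_surjective_of_length_lt [IsArtinianRing S] {P M : FGMod S} (hP : P.IsProj)
    {f : P.carrier →ₗ[S] M.carrier} (hf : Surjective f)
    (hker : ¬ IsSuperfluous (LinearMap.ker f)) :
    ∃ (Q : FGMod S) (g : Q.carrier →ₗ[S] M.carrier), Q.IsProj ∧ Surjective g ∧
      Module.length S Q.carrier < Module.length S P.carrier := by
  have hproj : Module.Projective S P.carrier := hP
  simp only [IsSuperfluous, not_forall] at hker
  obtain ⟨N, hN, hNtop⟩ := hker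
  have hfN : Surjective (f ∘ₗ N.subtype) := by
    intro m
    obtain ⟨p, rfl⟩ := hf m
    obtain ⟨n, hn, k, hk, rfl⟩ :=
      Submodule.mem_sup.1 (hN ▸ Submodule.mem_top : p ∈ N ⊔ LinearMap.ker f)
    exact ⟨⟨n, hn⟩, by simp [LinearMap.mem_ker.1 hk]⟩
  obtain ⟨h, hh⟩ := Module.projective_lifting_property (f ∘ₗ N.subtype) f hfN
  let e : Module.End S P.carrier := N.subtype ∘ₗ h
  have he (p : P.carrier) : f (e p) = f p := LinearMap.congr_fun hh p
  have hpow (n : ℕ) (p : P.carrier) : f ((e ^ n) p) = f p := by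
    induction n with
    | zero => simp
    | succ n ih => rw [pow_succ', Module.End.mul_apply, he, ih]
  obtain ⟨n, hcompl, hn⟩ :=
    (e.eventually_isCompl_ker_pow_range_pow.and (Filter.eventually_ge_atTop 1)).exists
  have hrange : LinearMap.range (e ^ n) ≤ N := by
    rintro _ ⟨p, rfl⟩
    obtain ⟨n, rfl⟩ := Nat.exists_eq_add_of_le' hn
    rw [pow_succ', Module.End.mul_apply]
    exact (h _).2
  refine ⟨⟨LinearMap.range (e ^ n)⟩, f ∘ₗ (LinearMap.range (e ^ n)).subtype, ?_, ?_, ?_⟩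
  · refine Module.Projective.of_split (LinearMap.range (e ^ n)).subtype
      (Submodule.projectionOnto _ _ hcompl.symm) ?_
    ext x
    simp
  · intro m
    obtain ⟨p, rfl⟩ := hf m
    exact ⟨⟨_, p, rfl⟩, hpow n p⟩
  · exact Submodule.length_lt fun htop => hNtop (top_le_iff.1 (htop ▸ hrange))

/-- Finitely generated modules over an Artinian ring have projective covers. -/
theorem exists_isProjCover [IsArtinianRing S] (M : FGMod S) :
    ∃ (P : FGMod S) (f : P.carrier →ₗ[S] M.carrier), IsProjCover f := by
  suffices H : ∀ (l : ℕ∞) (P : FGMod S) (f : P.carrier →ₗ[S] M.carrier), P.IsProj →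
      Surjective f → Module.length S P.carrier = l →
      ∃ (P : FGMod S) (f : P.carrier →ₗ[S] M.carrier), IsProjCover f by
    obtain ⟨n, f, hf⟩ := Module.Finite.exists_fin' S M.carrier
    exact H _ ⟨Fin n → S⟩ f (inferInstanceAs (Module.Projective S (Fin n → S))) hf rfl
  intro l
  induction l using WellFoundedLT.induction with
  | ind l ih =>
    rintro P f hP hf rfl
    by_cases hker : IsSuperfluous (LinearMap.ker f)
    · exact ⟨P, f, hP, hf, hker⟩
    · obtain ⟨Q, g, hQ, hg, hlt⟩ := exists_surjective_of_length_lt hP hf hker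
      exact ih _ hlt Q g hQ hg rfl

theorem isSyzygyOf_syz [IsArtinianRing S] (M : FGMod S) : IsSyzygyOf (syz M) M := by
  have h : ∃ N, IsSyzygyOf N M := by
    obtain ⟨P, f, hf⟩ := exists_isProjCover M
    exact ⟨⟨LinearMap.ker f⟩, P, f, hf, ⟨LinearEquiv.refl S _⟩⟩
  rw [syz, dif_pos h]
  exact h.choose_spec

theorem IsSummand.of_equiv {N M : FGMod S} (e : M.carrier ≃ₗ[S] N.carrier) : IsSummand N M :=
  ⟨⟨PUnit⟩, ⟨e.trans LinearEquiv.prodUnique.symm⟩⟩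

theorem IsSummand.refl (M : FGMod S) : IsSummand M M := .of_equiv (LinearEquiv.refl S _)

theorem IsSummand.trans {N M L : FGMod S} (h : IsSummand N M) (h' : IsSummand M L) :
    IsSummand N L := by
  obtain ⟨N', ⟨e⟩⟩ := h
  obtain ⟨M', ⟨e'⟩⟩ := h'
  exact ⟨FGMod.prodMod N' M', ⟨(e'.trans (e.prodCongr (LinearEquiv.refl S _))).trans
    (LinearEquiv.prodAssoc S _ _ _)⟩⟩

theorem IsSummand.dsum {n : ℕ} {N M : Fin n → FGMod S} (h : ∀ i, IsSummand (N i) (M i)) :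
    IsSummand (dsum N) (dsum M) := by
  choose N' e using h
  let k : (∀ i, (N i).carrier × (N' i).carrier) ≃ₗ[S]
      (∀ i, (N i).carrier) × (∀ i, (N' i).carrier) := {
    toFun := fun x => (fun i => (x i).1, fun i => (x i).2)
    invFun := fun x i => (x.1 i, x.2 i)
    map_add' := fun _ _ => rfl
    map_smul' := fun _ _ => rfl }
  exact ⟨FGMod.dsum N', ⟨(LinearEquiv.piCongrRight fun i => (e i).some).trans k⟩⟩

theorem IsSummand.syz [IsArtinianRing S] {N M : FGMod S} (h : IsSummand N M) :
    IsSummand (syz N) (syz M) := by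
  obtain ⟨N', ⟨e⟩⟩ := h
  exact ⟨FGMod.syz N', (isSyzygyOf_syz M).nonempty_equiv
    ((isSyzygyOf_syz N).prodMod (isSyzygyOf_syz N')) e⟩

theorem IsSummand.syz_iterate [IsArtinianRing S] {N M : FGMod S} (h : IsSummand N M) (n : ℕ) :
    IsSummand (FGMod.syz^[n] N) (FGMod.syz^[n] M) := by
  induction n with
  | zero => exact h
  | succ n ih =>
    rw [iterate_succ_apply', iterate_succ_apply']
    exact ih.syz

theorem subset_addOf (C : Set (FGMod S)) : C ⊆ addOf C := fun M hM =>
  ⟨1, fun _ => M, fun _ => hM, .of_equiv (LinearEquiv.funUnique (Fin 1) S M.carrier)⟩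

theorem addOf_mono {C D : Set (FGMod S)} (h : C ⊆ D) : addOf C ⊆ addOf D :=
  fun _ ⟨n, f, hf, hN⟩ => ⟨n, f, fun i => h (hf i), hN⟩

theorem mem_addOf_of_isSummand {C : Set (FGMod S)} {N M : FGMod S} (hM : M ∈ addOf C)
    (h : IsSummand N M) : N ∈ addOf C := by
  obtain ⟨n, f, hf, hMf⟩ := hM
  exact ⟨n, f, hf, h.trans hMf⟩

theorem addOf_addOf (C : Set (FGMod S)) : addOf (addOf C) = addOf C := by
  refine (subset_addOf _).antisymm' ?_
  rintro N ⟨m, f, hf, hN⟩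
  choose n g hg hfg using hf
  refine ⟨∑ i, n i, fun k => g (finSigmaFinEquiv.symm k).1 (finSigmaFinEquiv.symm k).2,
    fun k => hg _ _, hN.trans ((IsSummand.dsum hfg).trans (.of_equiv ?_))⟩
  exact ((LinearEquiv.piCongrLeft' S (fun x : (i : Fin m) × Fin (n i) => (g x.1 x.2).carrier)
    finSigmaFinEquiv).symm).trans (LinearEquiv.piCurry S fun i j => (g i j).carrier)

theorem syz_mem_addOf [IsArtinianRing S] {C : Set (FGMod S)} (hC : ∀ M ∈ C, syz M ∈ C)
    {M : FGMod S} (hM : M ∈ addOf C) : syz M ∈ addOf C := by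
  obtain ⟨n, f, hf, hMf⟩ := hM
  obtain ⟨e⟩ := (isSyzygyOf_syz (dsum f)).nonempty_equiv
    (IsSyzygyOf.dsum fun i => isSyzygyOf_syz (f i)) (LinearEquiv.refl S _)
  exact ⟨n, fun i => syz (f i), fun i => hC _ (hf i), hMf.syz.trans (.of_equiv e.symm)⟩

end FGMod

theorem phidim_mono (L : AddMonoid.End (K0 S)) {C D : Set (FGMod S)} (h : C ⊆ D) :
    phidim L C ≤ phidim L D :=
  biSup_mono fun _ hM => h hM

theorem gamma_le_of_isSummand [IsArtinianRing S] (L : AddMonoid.End (K0 S)) {N M : FGMod S}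
    (h : IsSummand N M) : gamma L N ≤ gamma L M :=
  phidim_mono L <| addOf_mono fun _ ⟨n, hn⟩ => ⟨n, hn.trans (h.syz_iterate n)⟩

theorem isZeroIT_of_gamma_eq_zero [IsArtinianRing S] {L : AddMonoid.End (K0 S)} {M : FGMod S}
    (h : gamma L M = 0) :
    IsZeroIT L (addOf {N : FGMod S | ∃ n : ℕ, IsSummand N (syz^[n] M)}) := by
  refine ⟨(addOf_addOf _).symm, fun N hN => syz_mem_addOf ?_ hN, h⟩
  rintro N ⟨n, hn⟩
  exact ⟨n + 1, by rw [iterate_succ_apply']; exact hn.syz⟩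

theorem IsZeroIT.gamma_eq_zero {L : AddMonoid.End (K0 S)} {D : Set (FGMod S)}
    (hD : IsZeroIT L D) {M : FGMod S} (hM : M ∈ D) : gamma L M = 0 := by
  obtain ⟨hadd, hsyz, hphi⟩ := hD
  have hiter (n : ℕ) : syz^[n] M ∈ D := by
    induction n with
    | zero => exact hM
    | succ n ih =>
      rw [iterate_succ_apply']
      exact hsyz _ ih
  have hsub : {N : FGMod S | ∃ n : ℕ, IsSummand N (syz^[n] M)} ⊆ D := by
    rintro N ⟨n, hn⟩
    rw [hadd]
    exact mem_addOf_of_isSummand (hadd ▸ hiter n) hn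
  exact le_antisymm (hphi ▸ phidim_mono L (hadd.symm ▸ addOf_mono hsub)) zero_le

/-- A non-projective module over an Artinian ring has an indecomposable non-projective direct
summand. -/
theorem exists_indec_summand [IsArtinianRing S] (M : FGMod S) (hM : ¬ M.IsProj) :
    ∃ N : FGMod S, Indec N ∧ ¬ N.IsProj ∧ IsSummand N M := by
  generalize hl : Module.length S M.carrier = l
  induction l using WellFoundedLT.induction generalizing M with
  | ind l ih =>
    subst hl
    have hns : ¬ Subsingleton M.carrier := fun _ => hM (by unfold IsProj; infer_instance)
    by_cases hind : Indec M
    · exact ⟨M, hind, hM, .refl M⟩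
    simp only [Indec, hns, not_false_eq_true, true_and, not_forall, not_or] at hind
    obtain ⟨N, N', ⟨e⟩, hN, hN'⟩ := hind
    have hlen := e.length_eq.trans (Module.length_prod S N.carrier N'.carrier)
    have : Nontrivial N.carrier := not_subsingleton_iff_nontrivial.1 hN
    have : Nontrivial N'.carrier := not_subsingleton_iff_nontrivial.1 hN'
    have hlt : Module.length S N.carrier < Module.length S M.carrier := by
      rw [hlen]
      simpa using (ENat.add_lt_add_iff_left Module.length_ne_top).2 Module.length_pos
    have hlt' : Module.length S N'.carrier < Module.length S M.carrier := by
      rw [hlen, add_comm]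
      simpa using (ENat.add_lt_add_iff_left Module.length_ne_top).2 Module.length_pos
    by_cases hproj : N.IsProj
    · have hproj' : ¬ N'.IsProj := fun h => hM <| by
        have : Module.Projective S N.carrier := hproj
        have : Module.Projective S N'.carrier := h
        exact Module.Projective.of_equiv e.symm
      obtain ⟨X, hX, hXp, hXs⟩ := ih _ hlt' N' hproj' rfl
      exact ⟨X, hX, hXp, hXs.trans ⟨N, ⟨e.trans (LinearEquiv.prodComm S _ _)⟩⟩⟩
    · obtain ⟨X, hX, hXp, hXs⟩ := ih _ hlt N hproj rfl
      exact ⟨X, hX, hXp, hXs.trans ⟨N', ⟨e⟩⟩⟩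

/-!
STATEMENT 16 (Proposition).  Let `A` be an Artin algebra.  The following are
equivalent:
(1) `A` has only trivial `0`-Igusa-Todorov subcategories (every `0`-Igusa-Todorov
    subcategory consists of projective modules);
(2) `γ(M) ≥ 1` for every non-projective `M ∈ mod A`;
(3) `γ(M) ≥ 1` for every indecomposable non-projective `M ∈ mod A`.
-/
theorem stmt_16 (R A : Type u) [CommRing R] [IsArtinianRing R] [Ring A] [Algebra R A]
    [Module.Finite R A]
    (L : AddMonoid.End (K0 Aᵐᵒᵖ)) (hL : IsSyzEnd L) :
    ((∀ D : Set (FGMod Aᵐᵒᵖ), IsZeroIT L D → ∀ M ∈ D, M.IsProj) ↔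
      (∀ M : FGMod Aᵐᵒᵖ, ¬ M.IsProj → 1 ≤ gamma L M)) ∧
    ((∀ M : FGMod Aᵐᵒᵖ, ¬ M.IsProj → 1 ≤ gamma L M) ↔
      (∀ M : FGMod Aᵐᵒᵖ, Indec M → ¬ M.IsProj → 1 ≤ gamma L M)) := by
  have : Module.Finite R Aᵐᵒᵖ := Module.Finite.equiv (MulOpposite.opLinearEquiv R)
  have : IsArtinianRing Aᵐᵒᵖ := IsArtinianRing.of_finite R Aᵐᵒᵖ
  refine ⟨⟨fun h M hM => Order.one_le_iff_ne_zero.2 fun h0 => ?_, fun h D hD M hM => ?_⟩,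
    fun h M _ hM => h M hM, fun h M hM => ?_⟩
  · exact hM (h _ (isZeroIT_of_gamma_eq_zero h0) M (subset_addOf _ ⟨0, .refl M⟩))
  · by_contra hproj
    exact Order.one_le_iff_ne_zero.1 (h M hproj) (hD.gamma_eq_zero hM)
  · obtain ⟨N, hN, hproj, hNM⟩ := exists_indec_summand M hM
    exact (h N hN hproj).trans (gamma_le_of_isSummand L hNM)
end LIT
end

section
/- The following algebras have only trivial 0-Igusa-Todorov subcategories: (1) any non-selfinjective radical square zero algebra A = kQ/J² such that Q is strongly connected and the adjacency matrix of Q is not invertible; (2) any truncated path algebra A = kQ/J^k (k ≥ 2) such that Q is strongly connected, Q has at least one loop, and the adjacency matrix of Q is not invertible. -/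
/-!
Common framework for formalizing "On Lat-Igusa-Todorov algebras" (Barrios–Mata).

For a ring `S`, `FGMod S` is the "category" of finitely generated (left) `S`-modules;
for an Artin algebra `A`, the category `mod A` of finitely generated *right*
`A`-modules is `FGMod Aᵐᵒᵖ`.
-/

universe u v

open Function

namespace LIT

open FGMod

variable {S : Type u} [Ring S]

/-! ### Path algebras of finite quivers, via generators and relations

A finite quiver is given by a vertex set `V`, an arrow set `E` and source/target
maps `s t : E → V`.  The path algebra `kQ` is presented as the quotient of the free
algebra on `V ⊕ E` by the relations making the vertices a complete set of orthogonal
idempotents and `e_{s(α)} x_α = x_α = x_α e_{t(α)}` for each arrow `α`; `kQ/J^m` is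
obtained by further killing all products of `m` arrows. -/

/-- The defining relations of the path algebra `kQ`. -/
inductive PathRel (k : Type u) [Field k] (V E : Type u) [Fintype V] [DecidableEq V]
    (s t : E → V) : FreeAlgebra k (V ⊕ E) → FreeAlgebra k (V ⊕ E) → Prop
  | vtx (v w : V) : PathRel k V E s t
      (FreeAlgebra.ι k (Sum.inl v) * FreeAlgebra.ι k (Sum.inl w))
      (if v = w then FreeAlgebra.ι k (Sum.inl v) else 0)
  | one : PathRel k V E s t (∑ v : V, FreeAlgebra.ι k (Sum.inl v)) 1
  | src (e : E) : PathRel k V E s t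
      (FreeAlgebra.ι k (Sum.inl (s e)) * FreeAlgebra.ι k (Sum.inr e))
      (FreeAlgebra.ι k (Sum.inr e))
  | tgt (e : E) : PathRel k V E s t
      (FreeAlgebra.ι k (Sum.inr e) * FreeAlgebra.ι k (Sum.inl (t e)))
      (FreeAlgebra.ι k (Sum.inr e))

/-- The path algebra `kQ`. -/
abbrev PathAlg (k : Type u) [Field k] (V E : Type u) [Fintype V] [DecidableEq V]
    (s t : E → V) : Type u :=
  RingQuot (PathRel k V E s t)

/-- The defining relations of the truncated path algebra `kQ/J^m`. -/
inductive TruncRel (k : Type u) [Field k] (V E : Type u) [Fintype V] [DecidableEq V]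
    (s t : E → V) (m : ℕ) : FreeAlgebra k (V ⊕ E) → FreeAlgebra k (V ⊕ E) → Prop
  | base {x y : FreeAlgebra k (V ⊕ E)} :
      PathRel k V E s t x y → TruncRel k V E s t m x y
  | trunc (f : Fin m → E) : TruncRel k V E s t m
      ((List.ofFn fun i => FreeAlgebra.ι k (Sum.inr (f i))).prod) 0

/-- The truncated path algebra `kQ/J^m`. -/
abbrev TruncPathAlg (k : Type u) [Field k] (V E : Type u) [Fintype V] [DecidableEq V]
    (s t : E → V) (m : ℕ) : Type u :=
  RingQuot (TruncRel k V E s t m)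

/-- The idempotent `e_v` of a vertex in the path algebra. -/
noncomputable def vtx (k : Type u) [Field k] {V E : Type u} [Fintype V] [DecidableEq V]
    (s t : E → V) (v : V) : PathAlg k V E s t :=
  RingQuot.mkRingHom (PathRel k V E s t) (FreeAlgebra.ι k (Sum.inl v))

/-- The generator `x_α` of an arrow in the path algebra. -/
noncomputable def arr (k : Type u) [Field k] {V E : Type u} [Fintype V] [DecidableEq V]
    (s t : E → V) (e : E) : PathAlg k V E s t :=
  RingQuot.mkRingHom (PathRel k V E s t) (FreeAlgebra.ι k (Sum.inr e))

/-- The adjacency matrix of the quiver: the `(i,j)` entry is the number of arrows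
from `i` to `j`. -/
noncomputable def adjMatrix (V E : Type u) (s t : E → V) : Matrix V V ℕ :=
  fun i j => Nat.card {e : E // s e = i ∧ t e = j}

/-- The quiver is strongly connected: there is a (directed) path between any two
vertices. -/
def StronglyConnected (V E : Type u) (s t : E → V) : Prop :=
  ∀ v w : V, Relation.ReflTransGen (fun a b => ∃ e : E, s e = a ∧ t e = b) v w

/-- The algebra has only trivial `0`-Igusa-Todorov subcategories: every
`0`-Igusa-Todorov subcategory of `mod A = FGMod S` consists of projective modules.
(`L` ranges over the endomorphism of `K₀` induced by the syzygy operator.) -/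
def OnlyTrivialZIT (S : Type u) [Ring S] : Prop :=
  ∀ L : AddMonoid.End (K0 S), IsSyzEnd L →
    ∀ D : Set (FGMod S), IsZeroIT L D → ∀ M ∈ D, M.IsProj

section TruncatedPathAlgebra

variable (k : Type u) [Field k] {V E : Type u} [Fintype V] [DecidableEq V] (s t : E → V) (m : ℕ)

/-- The opposite of `kQ/J^m`, whose left modules are the right modules of `kQ/J^m`. -/
abbrev TruncOp (k : Type u) [Field k] {V E : Type u} [Fintype V] [DecidableEq V]
    (s t : E → V) (m : ℕ) : Type u :=
  (TruncPathAlg k V E s t m)ᵐᵒᵖ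

/-- The vertex idempotents of `TruncOp`. -/
noncomputable def vertexIdem (v : V) : TruncOp k s t m :=
  .op (RingQuot.mkAlgHom k (TruncRel k V E s t m) (FreeAlgebra.ι k (Sum.inl v)))

/-- The arrows of `TruncOp`. -/
noncomputable def arrow (a : E) : TruncOp k s t m :=
  .op (RingQuot.mkAlgHom k (TruncRel k V E s t m) (FreeAlgebra.ι k (Sum.inr a)))

/-- The product of the arrows of a list; the head of the list is the last arrow of the path. -/
noncomputable def arrowProd (p : List E) : TruncOp k s t m := (p.map (arrow k s t m)).prod

local notation "𝔢" => vertexIdem k s t m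
local notation "𝔞" => arrow k s t m
local notation "𝔭" => arrowProd k s t m

lemma vertexIdem_mul_vertexIdem (v w : V) :
    𝔢 v * 𝔢 w = if v = w then 𝔢 v else 0 := by
  have h := RingQuot.mkAlgHom_rel k
    (TruncRel.base (m := m) (PathRel.vtx (k := k) (s := s) (t := t) w v))
  rw [map_mul] at h
  rw [vertexIdem, vertexIdem, ← MulOpposite.op_mul, h]
  by_cases hvw : v = w
  · subst hvw; simp
  · simp [hvw, Ne.symm hvw]

lemma sum_vertexIdem : ∑ v, 𝔢 v = 1 := by
  have h := RingQuot.mkAlgHom_rel k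
    (TruncRel.base (m := m) (PathRel.one (k := k) (s := s) (t := t)))
  rw [map_sum, map_one] at h
  simp only [vertexIdem, ← Finset.op_sum, h, MulOpposite.op_one]

lemma vertexIdem_mul_arrow (a : E) : 𝔢 (t a) * 𝔞 a = 𝔞 a := by
  have h := RingQuot.mkAlgHom_rel k
    (TruncRel.base (m := m) (PathRel.tgt (k := k) (s := s) (t := t) a))
  rw [map_mul] at h
  rw [vertexIdem, arrow, ← MulOpposite.op_mul, h]

lemma arrow_mul_vertexIdem (a : E) : 𝔞 a * 𝔢 (s a) = 𝔞 a := by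
  have h := RingQuot.mkAlgHom_rel k
    (TruncRel.base (m := m) (PathRel.src (k := k) (s := s) (t := t) a))
  rw [map_mul] at h
  rw [vertexIdem, arrow, ← MulOpposite.op_mul, h]

lemma vertexIdem_mul_arrow_of_ne {v : V} {a : E} (h : v ≠ t a) : 𝔢 v * 𝔞 a = 0 := by
  rw [← vertexIdem_mul_arrow, ← mul_assoc, vertexIdem_mul_vertexIdem, if_neg h, zero_mul]

lemma arrow_mul_vertexIdem_of_ne {v : V} {a : E} (h : s a ≠ v) : 𝔞 a * 𝔢 v = 0 := by
  rw [← arrow_mul_vertexIdem, mul_assoc, vertexIdem_mul_vertexIdem, if_neg h, mul_zero]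

@[simp] lemma arrowProd_nil : 𝔭 [] = 1 := rfl

@[simp] lemma arrowProd_cons (a : E) (p : List E) : 𝔭 (a :: p) = 𝔞 a * 𝔭 p := by
  simp [arrowProd]

lemma arrowProd_append (p q : List E) : 𝔭 (p ++ q) = 𝔭 p * 𝔭 q := by
  simp [arrowProd]

lemma arrowProd_of_length_eq {p : List E} (hp : p.length = m) : 𝔭 p = 0 := by
  have h := RingQuot.mkAlgHom_rel k
    (TruncRel.trunc (k := k) (s := s) (t := t) (m := m)
    (fun i => p.reverse.get (i.cast (by simp [hp]))))
  rw [map_list_prod, map_zero] at h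
  rw [← MulOpposite.unop_inj, arrowProd, MulOpposite.unop_list_prod, MulOpposite.unop_zero, ← h,
    List.map_map]
  congr 1
  subst hp
  apply List.ext_get
  · simp
  · intro n h1 h2
    simp [arrow]

lemma arrowProd_of_le_length {p : List E} (hp : m ≤ p.length) : 𝔭 p = 0 := by
  rw [← List.take_append_drop m p, arrowProd_append, arrowProd_of_length_eq, zero_mul]
  simpa using hp

variable {k s t m}

/-- Induction principle: `TruncOp` is generated by scalars, vertices and arrows. -/
lemma truncOp_induction {motive : TruncOp k s t m → Prop}
    (scalar : ∀ c : k, motive (algebraMap k _ c)) (vertex : ∀ v, motive (𝔢 v))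
    (arrow : ∀ a, motive (𝔞 a)) (mul : ∀ x y, motive x → motive y → motive (x * y))
    (add : ∀ x y, motive x → motive y → motive (x + y)) (x : TruncOp k s t m) : motive x := by
  obtain ⟨y, hy⟩ := RingQuot.mkAlgHom_surjective k (TruncRel k V E s t m) x.unop
  obtain rfl : x = .op (RingQuot.mkAlgHom k (TruncRel k V E s t m) y) := by rw [hy]; simp
  clear hy
  induction y with
  | grade0 r => simpa using scalar r
  | grade1 z =>
    rcases z with v | a
    exacts [vertex v, arrow a]
  | mul a b ha hb => simpa using mul _ _ hb ha
  | add a b ha hb => simpa using add _ _ ha hb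

variable {X Y : Type*} [AddCommGroup X] [AddCommGroup Y]

section LinearMap

variable [Module (TruncOp k s t m) X] [Module (TruncOp k s t m) Y]

/-- An additive map commuting with scalars, vertices and arrows is linear. -/
def linearOfCommute (f : X →+ Y)
    (scalar : ∀ (c : k) x, f (algebraMap k (TruncOp k s t m) c • x) =
      algebraMap k (TruncOp k s t m) c • f x)
    (vertex : ∀ v x, f (𝔢 v • x) = 𝔢 v • f x) (arrow : ∀ a x, f (𝔞 a • x) = 𝔞 a • f x) :
    X →ₗ[TruncOp k s t m] Y where
  toFun := f
  map_add' := f.map_add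
  map_smul' r := by
    induction r using truncOp_induction with
    | scalar c => exact scalar c
    | vertex v => exact vertex v
    | arrow a => exact arrow a
    | mul x y hx hy => intro z; simp_all [mul_smul]
    | add x y hx hy => intro z; simp_all [add_smul]

end LinearMap

/-- The ring homomorphism into the endomorphisms of a vector space given by a representation of
the quiver with relations. -/
noncomputable def repHom [Module k X] (e : V → Module.End k X) (x : E → Module.End k X)
    (vtx : ∀ v w, e v * e w = if v = w then e v else 0) (one : ∑ v, e v = 1)
    (src : ∀ a, x a * e (s a) = x a) (tgt : ∀ a, e (t a) * x a = x a)
    (trunc : ∀ p : List E, p.length = m → (p.map x).prod = 0) :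
    TruncOp k s t m →ₐ[k] Module.End k X :=
  AlgHom.opComm (RingQuot.liftAlgHom k
    ⟨FreeAlgebra.lift k (fun z => .op (z.elim e x)), by
      intro a b h
      induction h with
      | base h =>
        cases h with
        | vtx v w =>
          simp only [map_mul, FreeAlgebra.lift_ι_apply, Sum.elim_inl, ← MulOpposite.op_mul, vtx]
          by_cases hvw : v = w
          · subst hvw; simp
          · simp [hvw, Ne.symm hvw]
        | one => simp [← Finset.op_sum, one]
        | src a => simp [← MulOpposite.op_mul, src]
        | tgt a => simp [← MulOpposite.op_mul, tgt]
      | trunc f =>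
        have := trunc (List.ofFn f).reverse (by simp)
        rw [map_list_prod, map_zero, ← MulOpposite.unop_inj, MulOpposite.unop_list_prod,
          MulOpposite.unop_zero, ← this]
        simp [List.map_reverse, List.map_ofFn, comp_def]⟩)

section repHom
variable [Module k X] (e : V → Module.End k X) (x : E → Module.End k X)
    (vtx : ∀ v w, e v * e w = if v = w then e v else 0) (one : ∑ v, e v = 1)
    (src : ∀ a, x a * e (s a) = x a) (tgt : ∀ a, e (t a) * x a = x a)
    (trunc : ∀ p : List E, p.length = m → (p.map x).prod = 0)

lemma repHom_vertexIdem (v : V) :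
    repHom e x vtx one src tgt trunc (𝔢 v) = e v := by
  simp [repHom, vertexIdem, AlgHom.opComm]

lemma repHom_arrow (a : E) :
    repHom e x vtx one src tgt trunc (𝔞 a) = x a := by
  simp [repHom, arrow, AlgHom.opComm]

end repHom

end TruncatedPathAlgebra

section PathModule

variable (k : Type u) [Field k] {V E : Type u} [Fintype V] [DecidableEq V] (s t : E → V) (m : ℕ)
  {I : Type u} (b : I → V) (r : ℕ)

/-- The end of the path starting at `v` whose arrows, last one first, are in the list. -/
def endVertex (t : E → V) (v : V) : List E → V
  | [] => v
  | a :: _ => t a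

/-- The list, read from its last element to its head, is a path starting at `v`. -/
def IsPath (s t : E → V) (v : V) : List E → Prop
  | [] => True
  | a :: p => s a = endVertex t v p ∧ IsPath s t v p

omit [Fintype V] [DecidableEq V] in
lemma endVertex_append (v : V) (p q : List E) :
    endVertex t v (p ++ q) = endVertex t (endVertex t v q) p := by
  cases p <;> rfl

omit [Fintype V] [DecidableEq V] in
lemma isPath_append (v : V) (p q : List E) :
    IsPath s t v (p ++ q) ↔ IsPath s t (endVertex t v q) p ∧ IsPath s t v q := by
  induction p with
  | nil => simp [IsPath]
  | cons a p ih => simp [IsPath, ih, endVertex_append, and_assoc]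

/-- The pairs of an index `i` and a path from `b i` of length less than `r` and `m`. -/
def IsBasisPath (x : I × List E) : Prop :=
  IsPath s t (b x.1) x.2 ∧ x.2.length < r ∧ x.2.length < m

/-- The direct sum of the modules `e_{b i} A / e_{b i} J^r`, with `A = kQ/J^m`. -/
def PathMod : Type u := {x : I × List E // IsBasisPath s t m b r x} →₀ k

noncomputable instance : AddCommGroup (PathMod k s t m b r) :=
  inferInstanceAs (AddCommGroup ({x : I × List E // IsBasisPath s t m b r x} →₀ k))

noncomputable instance : Module k (PathMod k s t m b r) :=
  inferInstanceAs (Module k ({x : I × List E // IsBasisPath s t m b r x} →₀ k))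

omit [Fintype V] [DecidableEq V] in
variable {s t m b r} in
lemma IsBasisPath.of_cons {i : I} {a : E} {p : List E} (h : IsBasisPath s t m b r (i, a :: p)) :
    IsBasisPath s t m b r (i, p) :=
  ⟨h.1.2, (Nat.lt_succ_self _).trans h.2.1, (Nat.lt_succ_self _).trans h.2.2⟩

namespace PathMod

/-- The multiples of a basis vector. -/
noncomputable def single (y : {x : I × List E // IsBasisPath s t m b r x}) :
    k →ₗ[k] PathMod k s t m b r := Finsupp.lsingle y

/-- The coordinate functions of the basis. -/
noncomputable def coord (y : {x : I × List E // IsBasisPath s t m b r x}) :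
    PathMod k s t m b r →ₗ[k] k := Finsupp.lapply y

open Classical in
/-- The element of the path module given by a path, `0` if the path is too long. -/
noncomputable def bas (i : I) (p : List E) : PathMod k s t m b r :=
  if h : IsBasisPath s t m b r (i, p) then single k s t m b r ⟨(i, p), h⟩ 1 else 0

open Classical in
/-- The coefficient of a path. -/
noncomputable def coef (i : I) (p : List E) : PathMod k s t m b r →ₗ[k] k :=
  if h : IsBasisPath s t m b r (i, p) then coord k s t m b r ⟨(i, p), h⟩ else 0

variable {k s t m b r}

omit [Fintype V] [DecidableEq V] in
lemma bas_of {i : I} {p : List E} (h : IsBasisPath s t m b r (i, p)) :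
    bas k s t m b r i p = single k s t m b r ⟨(i, p), h⟩ 1 := dif_pos h

omit [Fintype V] [DecidableEq V] in
lemma coef_of {i : I} {p : List E} (h : IsBasisPath s t m b r (i, p)) :
    coef k s t m b r i p = coord k s t m b r ⟨(i, p), h⟩ := dif_pos h

omit [Fintype V] [DecidableEq V] in
lemma bas_of_not {i : I} {p : List E} (h : ¬ IsBasisPath s t m b r (i, p)) :
    bas k s t m b r i p = 0 := dif_neg h

omit [Fintype V] [DecidableEq V] in
lemma coef_of_not {i : I} {p : List E} (h : ¬ IsBasisPath s t m b r (i, p)) :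
    coef k s t m b r i p = 0 := dif_neg h

omit [Fintype V] [DecidableEq V] in
open Classical in
lemma coef_bas (i j : I) (p q : List E) :
    coef k s t m b r i p (bas k s t m b r j q) =
      if (j, q) = (i, p) ∧ IsBasisPath s t m b r (i, p) then 1 else 0 := by
  by_cases h : IsBasisPath s t m b r (i, p)
  · by_cases h' : IsBasisPath s t m b r (j, q)
    · rw [coef_of h, bas_of h']
      refine (Finsupp.single_apply ..).trans ?_
      simp [h, Subtype.ext_iff]
    · rw [bas_of_not h', map_zero, if_neg]
      rintro ⟨h1, h2⟩
      exact h' (h1 ▸ h2)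
  · simp [coef_of_not h, h]

omit [Fintype V] [DecidableEq V] in
lemma coef_ext {z z' : PathMod k s t m b r}
    (h : ∀ i p, coef k s t m b r i p z = coef k s t m b r i p z') : z = z' := by
  refine Finsupp.ext fun ⟨⟨i, p⟩, hx⟩ => ?_
  have := h i p
  rw [coef_of hx] at this
  exact this

omit [Fintype V] [DecidableEq V] in
@[elab_as_elim]
protected lemma induction {motive : PathMod k s t m b r → Prop} (zero : motive 0)
    (add : ∀ y z, motive y → motive z → motive (y + z))
    (bas : ∀ (c : k) i p, IsBasisPath s t m b r (i, p) → motive (c • bas k s t m b r i p)) (z) :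
    motive z := by
  refine Finsupp.induction_linear z zero add fun ⟨⟨i, p⟩, hx⟩ c => ?_
  have h := bas c i p hx
  rw [bas_of hx, ← map_smul, smul_eq_mul, mul_one] at h
  exact h

omit [Fintype V] [DecidableEq V] in
lemma klinear_ext {Y : Type*} [AddCommGroup Y] [Module k Y] {f g : PathMod k s t m b r →ₗ[k] Y}
    (h : ∀ i p, f (bas k s t m b r i p) = g (bas k s t m b r i p)) : f = g := by
  ext z
  induction z using PathMod.induction with
  | zero => simp
  | add y z hy hz => simp [hy, hz]
  | bas c i p => simp [h]

/-- The linear map with prescribed values on the paths. -/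
noncomputable def klift {Y : Type*} [AddCommGroup Y] [Module k Y] (f : I → List E → Y) :
    PathMod k s t m b r →ₗ[k] Y :=
  Finsupp.linearCombination k (fun x => f x.1.1 x.1.2)

omit [Fintype V] [DecidableEq V] in
lemma klift_bas {Y : Type*} [AddCommGroup Y] [Module k Y] (f : I → List E → Y) {i : I} {p : List E}
    (h : ¬ IsBasisPath s t m b r (i, p) → f i p = 0) :
    klift f (bas k s t m b r i p) = f i p := by
  by_cases hx : IsBasisPath s t m b r (i, p)
  · rw [bas_of hx]
    exact (Finsupp.linearCombination_single ..).trans (one_smul _ _)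
  · rw [bas_of_not hx, h hx, map_zero]

/-- The action of an arrow. -/
noncomputable def arrowEnd (a : E) : Module.End k (PathMod k s t m b r) :=
  klift fun i p => bas k s t m b r i (a :: p)

/-- The action of a vertex. -/
noncomputable def vertexEnd (v : V) : Module.End k (PathMod k s t m b r) :=
  klift fun i p => if endVertex t (b i) p = v then bas k s t m b r i p else 0

omit [Fintype V] [DecidableEq V] in
lemma arrowEnd_bas (a : E) (i : I) (p : List E) :
    arrowEnd a (bas k s t m b r i p) = bas k s t m b r i (a :: p) :=
  klift_bas _ fun h => bas_of_not fun h' => h h'.of_cons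

omit [Fintype V] in
lemma vertexEnd_bas (v : V) (i : I) (p : List E) :
    vertexEnd v (bas k s t m b r i p) =
      if endVertex t (b i) p = v then bas k s t m b r i p else 0 :=
  klift_bas _ fun h => by simp [bas_of_not h]

omit [Fintype V] [DecidableEq V] in
lemma prod_arrowEnd_bas (i : I) (q p : List E) :
    (q.map arrowEnd).prod (bas k s t m b r i p) = bas k s t m b r i (q ++ p) := by
  induction q with
  | nil => rfl
  | cons a q ih => simp [ih, arrowEnd_bas]

variable (k s t m b r) in
/-- The structure of a representation on the path module. -/
noncomputable def rep : TruncOp k s t m →ₐ[k] Module.End k (PathMod k s t m b r) :=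
  repHom vertexEnd arrowEnd
    (fun v w => klinear_ext fun i p => by
      by_cases h : endVertex t (b i) p = w
      · by_cases h' : v = w
        · simp [vertexEnd_bas, h, h']
        · simp [vertexEnd_bas, h, h', Ne.symm h']
      · by_cases h' : v = w
        · simp [vertexEnd_bas, h, h']
        · simp [vertexEnd_bas, h, h'])
    (klinear_ext fun i p => by simp [vertexEnd_bas])
    (fun a => klinear_ext fun i p => by
      by_cases h : endVertex t (b i) p = s a
      · simp [vertexEnd_bas, h]
      · have : ¬ IsBasisPath s t m b r (i, a :: p) := fun h' => h h'.1.1.symm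
        simp [vertexEnd_bas, arrowEnd_bas, h, bas_of_not this])
    (fun a => klinear_ext fun i p => by simp [vertexEnd_bas, arrowEnd_bas, endVertex])
    (fun p hp => klinear_ext fun i q => by
      rw [prod_arrowEnd_bas, bas_of_not, LinearMap.zero_apply]
      rintro ⟨-, -, h⟩
      simp [hp] at h)

noncomputable instance : Module (TruncOp k s t m) (PathMod k s t m b r) :=
  Module.compHom _ (rep k s t m b r).toRingHom

lemma smul_def (x : TruncOp k s t m) (z : PathMod k s t m b r) :
    x • z = rep k s t m b r x z := rfl

instance : IsScalarTower k (TruncOp k s t m) (PathMod k s t m b r) where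
  smul_assoc c x z := by simp [smul_def]

@[simp] lemma arrow_smul_bas (a : E) (i : I) (p : List E) :
    arrow k s t m a • bas k s t m b r i p = bas k s t m b r i (a :: p) := by
  rw [smul_def, rep, repHom_arrow, arrowEnd_bas]

@[simp] lemma vertexIdem_smul_bas (v : V) (i : I) (p : List E) :
    vertexIdem k s t m v • bas k s t m b r i p =
      if endVertex t (b i) p = v then bas k s t m b r i p else 0 := by
  rw [smul_def, rep, repHom_vertexIdem, vertexEnd_bas]

lemma algebraMap_smul (c : k) (z : PathMod k s t m b r) :
    algebraMap k (TruncOp k s t m) c • z = c • z := by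
  rw [smul_def, AlgHom.commutes, Module.algebraMap_end_apply]

lemma smul_comm' (c : k) (x : TruncOp k s t m) (z : PathMod k s t m b r) :
    x • c • z = c • x • z := by
  simp [smul_def]

lemma arrowProd_smul_bas (q : List E) (i : I) (p : List E) :
    arrowProd k s t m q • bas k s t m b r i p = bas k s t m b r i (q ++ p) := by
  induction q with
  | nil => simp
  | cons a q ih => simp [ih, mul_smul]

lemma bas_eq (i : I) (p : List E) :
    bas k s t m b r i p = arrowProd k s t m p • bas k s t m b r i [] := by
  simp [arrowProd_smul_bas]

/-- Paths of length `r` annihilate the path module. -/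
lemma arrowProd_smul {p : List E} (hp : p.length = r) (z : PathMod k s t m b r) :
    arrowProd k s t m p • z = 0 := by
  induction z using PathMod.induction with
  | zero => simp
  | add y z hy hz => simp [hy, hz]
  | bas c i q =>
    rw [smul_comm', arrowProd_smul_bas, bas_of_not, smul_zero]
    rintro ⟨-, h, -⟩
    simp [hp] at h

lemma coef_arrow_smul_nil (a : E) (z : PathMod k s t m b r) (i : I) :
    coef k s t m b r i [] (arrow k s t m a • z) = 0 := by
  induction z using PathMod.induction with
  | zero => simp
  | add y z hy hz => simp [hy, hz]
  | bas c j q => simp [smul_comm', coef_bas]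

lemma coef_arrow_smul_cons {a : E} (z : PathMod k s t m b r) {i : I} {p : List E}
    (h : IsBasisPath s t m b r (i, a :: p)) :
    coef k s t m b r i (a :: p) (arrow k s t m a • z) = coef k s t m b r i p z := by
  induction z using PathMod.induction with
  | zero => simp
  | add y z hy hz => simp [hy, hz]
  | bas c j q =>
    rw [smul_comm', arrow_smul_bas, map_smul, map_smul, coef_bas, coef_bas]
    have h' := h.of_cons
    by_cases e : (j, q) = (i, p)
    · obtain ⟨rfl, rfl⟩ := Prod.mk.inj e
      rw [if_pos ⟨rfl, h⟩, if_pos ⟨rfl, h'⟩]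
    · rw [if_neg, if_neg fun h => e h.1]
      rintro ⟨h, -⟩
      exact e (by simpa using h)

lemma coef_arrowProd_smul (z : PathMod k s t m b r) {i : I} {p : List E}
    (h : IsBasisPath s t m b r (i, p)) :
    coef k s t m b r i p (arrowProd k s t m p • z) = coef k s t m b r i [] z := by
  induction p with
  | nil => simp
  | cons a p ih => rw [arrowProd_cons, mul_smul, coef_arrow_smul_cons _ h, ih h.of_cons]

lemma coef_vertexIdem_smul (v : V) (z : PathMod k s t m b r) (i : I) (p : List E) :
    coef k s t m b r i p (vertexIdem k s t m v • z) =
      if endVertex t (b i) p = v then coef k s t m b r i p z else 0 := by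
  induction z using PathMod.induction with
  | zero => simp
  | add y z hy hz =>
    simp only [smul_add, map_add, hy, hz]
    split_ifs <;> simp
  | bas c j q =>
    rw [smul_comm', vertexIdem_smul_bas]
    by_cases h : (j, q) = (i, p)
    · obtain ⟨rfl, rfl⟩ := Prod.mk.inj h
      split_ifs <;> simp
    · split_ifs <;> simp [coef_bas, h]

section lift

variable {X : Type*} [AddCommGroup X] [Module (TruncOp k s t m) X]

lemma arrowProd_smul_eq_zero {v : V} {x : X} (hx : vertexIdem k s t m v • x = x) {p : List E}
    (hp : ¬ IsPath s t v p) : arrowProd k s t m p • x = 0 := by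
  suffices H : ∀ p, (IsPath s t v p → vertexIdem k s t m (endVertex t v p) •
      arrowProd k s t m p • x = arrowProd k s t m p • x) ∧
      (¬ IsPath s t v p → arrowProd k s t m p • x = 0) from (H p).2 hp
  intro p
  induction p with
  | nil => simp [IsPath, endVertex, hx]
  | cons a p ih =>
    constructor
    · intro _
      rw [arrowProd_cons, endVertex, ← mul_smul, ← mul_assoc, vertexIdem_mul_arrow]
    · intro h
      rw [arrowProd_cons, mul_smul]
      by_cases hp : IsPath s t v p
      · rw [← ih.1 hp, ← mul_smul, arrow_mul_vertexIdem_of_ne, zero_smul]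
        exact fun h' => h ⟨h', hp⟩
      · rw [ih.2 hp, smul_zero]

lemma arrowProd_smul_of_le_length {x : X} {n : ℕ}
    (h : ∀ p : List E, p.length = n → arrowProd k s t m p • x = 0)
    {p : List E} (hp : n ≤ p.length) : arrowProd k s t m p • x = 0 := by
  rw [← List.take_append_drop (p.length - n) p, arrowProd_append, mul_smul, h, smul_zero]
  simp
  omega

variable (x : I → X) (hx : ∀ i, vertexIdem k s t m (b i) • x i = x i)
  (hr : ∀ i (p : List E), p.length = r → arrowProd k s t m p • x i = 0)

/-- The additive map underlying `lift`. -/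
noncomputable def liftAux : PathMod k s t m b r →+ X :=
  Finsupp.liftAddHom (fun y => ((smulAddHom (TruncOp k s t m) X).flip
    (arrowProd k s t m y.1.2 • x y.1.1)).comp (algebraMap k (TruncOp k s t m)).toAddMonoidHom)

include hx hr in
lemma liftAux_bas (c : k) (i : I) (p : List E) :
    liftAux x (c • bas k s t m b r i p) =
      algebraMap k (TruncOp k s t m) c • arrowProd k s t m p • x i := by
  by_cases h : IsBasisPath s t m b r (i, p)
  · rw [bas_of h, ← map_smul, smul_eq_mul, mul_one]
    exact Finsupp.liftAddHom_apply_single _ _ _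
  · rw [bas_of_not h, smul_zero, map_zero]
    suffices arrowProd k s t m p • x i = 0 by rw [this, smul_zero]
    by_cases h1 : IsPath s t (b i) p
    · by_cases h2 : p.length < r
      · rw [arrowProd_of_le_length, zero_smul]
        by_contra! h3
        exact h ⟨h1, h2, h3⟩
      · exact arrowProd_smul_of_le_length (hr i) (not_lt.1 h2)
    · exact arrowProd_smul_eq_zero (hx i) h1

/-- The universal property of the path module. -/
noncomputable def lift : PathMod k s t m b r →ₗ[TruncOp k s t m] X :=
  linearOfCommute (liftAux x)
    (fun c z => by
      induction z using PathMod.induction with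
      | zero => simp
      | add y z hy hz => rw [smul_add, map_add, hy, hz, map_add, smul_add]
      | bas c' i p =>
        rw [algebraMap_smul, smul_smul, liftAux_bas x hx hr, liftAux_bas x hx hr, map_mul,
          mul_smul])
    (fun v z => by
      induction z using PathMod.induction with
      | zero => simp
      | add y z hy hz => simp [hy, hz]
      | bas c i p =>
        rw [smul_comm', vertexIdem_smul_bas, liftAux_bas x hx hr, smul_smul, ← Algebra.commutes,
          mul_smul, smul_smul (vertexIdem k s t m v)]
        have key : vertexIdem k s t m (endVertex t (b i) p) • arrowProd k s t m p • x i =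
            arrowProd k s t m p • x i := by
          cases p with
          | nil => simpa [endVertex] using hx i
          | cons a p =>
            rw [arrowProd_cons, endVertex, ← mul_smul, ← mul_assoc, vertexIdem_mul_arrow]
        split_ifs with h
        · rw [liftAux_bas x hx hr, mul_smul, ← h, key]
        · rw [mul_smul, ← key, ← mul_smul (vertexIdem k s t m v), vertexIdem_mul_vertexIdem,
            if_neg (Ne.symm h)]
          simp)
    (fun a z => by
      induction z using PathMod.induction with
      | zero => simp
      | add y z hy hz => simp [hy, hz]
      | bas c i p =>
        rw [smul_comm', arrow_smul_bas, liftAux_bas x hx hr, liftAux_bas x hx hr, arrowProd_cons,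
          mul_smul, ← mul_smul, ← mul_smul _ (algebraMap _ _ c), Algebra.commutes])

lemma lift_bas (i : I) (p : List E) :
    lift x hx hr (bas k s t m b r i p) = arrowProd k s t m p • x i := by
  have := liftAux_bas x hx hr 1 i p
  rwa [one_smul, map_one, one_smul] at this

omit hx hr in
lemma hom_ext {f g : PathMod k s t m b r →ₗ[TruncOp k s t m] X}
    (h : ∀ i, f (bas k s t m b r i []) = g (bas k s t m b r i [])) : f = g := by
  ext z
  induction z using PathMod.induction with
  | zero => simp
  | add y z hy hz => simp [hy, hz]
  | bas c i p => rw [← algebraMap_smul, map_smul, map_smul, bas_eq, map_smul, map_smul, h]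

end lift

end PathMod

end PathModule

section General

/-- A retraction with a section splits off a direct summand. -/
def splitEquiv {X Y : Type*} [AddCommGroup X] [AddCommGroup Y] [Module S X] [Module S Y]
    (i : X →ₗ[S] Y) (p : Y →ₗ[S] X) (h : ∀ x, p (i x) = x) : Y ≃ₗ[S] X × LinearMap.ker p where
  toFun y := (p y, ⟨y - i (p y), by simp [h]⟩)
  map_add' y z := by ext <;> simp; abel
  map_smul' c y := by ext <;> simp [smul_sub]
  invFun z := i z.1 + z.2
  left_inv y := by simp
  right_inv z := by
    have := z.2.2
    rw [LinearMap.mem_ker] at this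
    ext <;> simp [h, this]

lemma finite_ker_of_section {X Y : Type*} [AddCommGroup X] [AddCommGroup Y] [Module S X]
    [Module S Y] [Module.Finite S Y] (i : X →ₗ[S] Y) (p : Y →ₗ[S] X) (h : ∀ x, p (i x) = x) :
    Module.Finite S (LinearMap.ker p) :=
  Module.Finite.of_surjective
    ((LinearMap.snd S X (LinearMap.ker p)).comp (splitEquiv i p h).toLinearMap)
    fun x => ⟨(splitEquiv i p h).symm (0, x), by simp⟩

lemma isSummand_of_section {X Y : FGMod S} (i : X.carrier →ₗ[S] Y.carrier)
    (p : Y.carrier →ₗ[S] X.carrier) (h : ∀ x, p (i x) = x) : IsSummand X Y :=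
  have := finite_ker_of_section i p h
  ⟨⟨LinearMap.ker p⟩, ⟨splitEquiv i p h⟩⟩

lemma exists_section_of_isSummand {X Y : FGMod S} (h : IsSummand X Y) :
    ∃ (i : X.carrier →ₗ[S] Y.carrier) (p : Y.carrier →ₗ[S] X.carrier), ∀ x, p (i x) = x := by
  obtain ⟨N, ⟨e⟩⟩ := h
  exact ⟨e.symm.toLinearMap.comp (LinearMap.inl S _ _), (LinearMap.fst S _ _).comp e.toLinearMap,
    fun x => by simp⟩

lemma mem_addOf_of_summand {C : Set (FGMod S)} {X Y : FGMod S} (hY : Y ∈ C)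
    (i : X.carrier →ₗ[S] Y.carrier) (p : Y.carrier →ₗ[S] X.carrier) (h : ∀ x, p (i x) = x) :
    X ∈ addOf C := by
  refine ⟨1, fun _ => Y, fun _ => hY, isSummand_of_section (Y := dsum fun _ : Fin 1 => Y)
    (LinearMap.pi fun _ => i) (p.comp (LinearMap.proj 0)) fun x => ?_⟩
  exact h x

lemma mem_addOf_of_equiv {C : Set (FGMod S)} {X : FGMod S} {n : ℕ} {f : Fin n → FGMod S}
    (hf : ∀ i, f i ∈ C) (e : X.carrier ≃ₗ[S] (dsum f).carrier) : X ∈ addOf C :=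
  ⟨n, f, hf, isSummand_of_section e.toLinearMap e.symm.toLinearMap fun x => by simp⟩

lemma toK0_of_equiv_prod {M M' M'' : FGMod S} (e : M.carrier ≃ₗ[S] M'.carrier × M''.carrier) :
    toK0 M = toK0 M' + toK0 M'' := by
  have h : FreeAbelianGroup.of M - FreeAbelianGroup.of M' - FreeAbelianGroup.of M'' ∈ K0Rels S :=
    AddSubgroup.subset_closure (Or.inl ⟨M, M', M'', ⟨e⟩, rfl⟩)
  rw [sub_sub, ← neg_mem_iff, neg_sub, ← neg_add_eq_sub, ← QuotientAddGroup.eq] at h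
  exact h

lemma toK0_of_isProj {P : FGMod S} (h : P.IsProj) : toK0 P = 0 :=
  (QuotientAddGroup.eq_zero_iff _).2 (AddSubgroup.subset_closure (Or.inr ⟨P, h, rfl⟩))

lemma toK0_of_subsingleton (P : FGMod S) [Subsingleton P.carrier] : toK0 P = 0 :=
  toK0_of_isProj (inferInstanceAs (Module.Projective S P.carrier))

lemma toK0_congr {M N : FGMod S} (e : M.carrier ≃ₗ[S] N.carrier) : toK0 M = toK0 N := by
  have := toK0_of_equiv_prod (M := M) (M' := N) (M'' := ⟨PUnit⟩)
    (e.trans LinearEquiv.prodUnique.symm)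
  rw [this, toK0_of_subsingleton ⟨PUnit⟩, add_zero]

lemma toK0_dsum {n : ℕ} (f : Fin n → FGMod S) : toK0 (dsum f) = ∑ i, toK0 (f i) := by
  induction n with
  | zero =>
    have : Subsingleton (dsum f).carrier := inferInstanceAs (Subsingleton (∀ i, (f i).carrier))
    simp [toK0_of_subsingleton]
  | succ n ih =>
    rw [Fin.sum_univ_succ, ← ih]
    exact toK0_of_equiv_prod (M'' := dsum fun i => f i.succ)
      (Fin.consLinearEquiv S (fun i => (f i).carrier)).symm

/-- Projective covers are unique up to isomorphism. -/
lemma isSyzygyOf_unique {M N N' : FGMod S} (h : IsSyzygyOf N M) (h' : IsSyzygyOf N' M) :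
    Nonempty (N.carrier ≃ₗ[S] N'.carrier) := by
  obtain ⟨P, f, ⟨hP, hf, hf'⟩, ⟨e⟩⟩ := h
  obtain ⟨P', f', ⟨hP', hf2, hf2'⟩, ⟨e'⟩⟩ := h'
  unfold FGMod.IsProj at hP hP'
  obtain ⟨g, hg⟩ := Module.projective_lifting_property f' f hf2
  have hgx (x) : f' (g x) = f x := LinearMap.congr_fun hg x
  have g_surj : Surjective g := by
    rw [← LinearMap.range_eq_top]
    refine hf2' _ (eq_top_iff.2 fun y _ => ?_)
    obtain ⟨x, hx⟩ := hf (f' y)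
    rw [Submodule.mem_sup]
    exact ⟨g x, ⟨x, rfl⟩, y - g x, by simp [hgx, hx], by simp⟩
  obtain ⟨σ, hσ⟩ := Module.projective_lifting_property g LinearMap.id g_surj
  have hσx (x) : g (σ x) = x := LinearMap.congr_fun hσ x
  have σ_range : LinearMap.range σ = ⊤ := by
    refine hf' _ (eq_top_iff.2 fun y _ => ?_)
    rw [Submodule.mem_sup]
    exact ⟨σ (g y), ⟨_, rfl⟩, y - σ (g y), by simp [← hgx, hσx], by simp⟩
  have g_inj : Injective g := by
    intro x y hxy
    obtain ⟨x, rfl⟩ := LinearMap.range_eq_top.1 σ_range x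
    obtain ⟨y, rfl⟩ := LinearMap.range_eq_top.1 σ_range y
    rw [hσx, hσx] at hxy
    rw [hxy]
  let G := LinearEquiv.ofBijective g ⟨g_inj, g_surj⟩
  have hmap : (LinearMap.ker f).map (G : P.carrier →ₗ[S] P'.carrier) = LinearMap.ker f' := by
    ext y
    constructor
    · rintro ⟨x, hx, rfl⟩
      exact (hgx x).trans hx
    · intro hy
      obtain ⟨x, rfl⟩ := g_surj y
      exact ⟨x, (hgx x).symm.trans hy, rfl⟩
  exact ⟨e.trans ((G.submoduleMap _).trans ((LinearEquiv.ofEq _ _ hmap).trans e'.symm))⟩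

lemma isSyzygyOf_syz {M N : FGMod S} (h : IsSyzygyOf N M) : IsSyzygyOf (syz M) M := by
  have h' : ∃ N, IsSyzygyOf N M := ⟨N, h⟩
  unfold syz
  rw [dif_pos h']
  exact h'.choose_spec

lemma syz_equiv {M N : FGMod S} (h : IsSyzygyOf N M) :
    Nonempty (N.carrier ≃ₗ[S] (syz M).carrier) :=
  isSyzygyOf_unique h (isSyzygyOf_syz h)

/-- Fitting's lemma: if `φ` vanishes on a finitely generated group, then `L` is injective on it. -/
lemma injOn_of_eta_eq_zero {G : Type v} [AddCommGroup G] (L : AddMonoid.End G)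
    {X : AddSubgroup G} (hX : X.FG) (h : eta L X = 0) : Set.InjOn L (X : Set G) := by
  have hne : {k : ℕ | ∀ m : ℕ, k ≤ m → Set.InjOn L (X.map (L ^ m) : Set G)}.Nonempty := by
    let X' := AddSubgroup.toIntSubmodule X
    have : Module.Finite ℤ X' := by
      rw [Module.Finite.iff_fg, Submodule.fg_iff_addSubgroup_fg]
      exact hX
    let f : ℕ →o Submodule ℤ X' :=
      ⟨fun n => LinearMap.ker (((L ^ n : AddMonoid.End G) : G →+ G).toIntLinearMap.comp X'.subtype),
        monotone_nat_of_le_succ fun n x hx => by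
          simp only [LinearMap.mem_ker, LinearMap.comp_apply] at hx ⊢
          rw [pow_succ']
          exact (congrArg L hx).trans (map_zero L)⟩
    obtain ⟨n, hn⟩ := monotone_stabilizes_iff_noetherian.2 (inferInstanceAs (IsNoetherian ℤ X')) f
    refine ⟨n, fun m hm => ?_⟩
    rintro _ ⟨x, hx, rfl⟩ _ ⟨y, hy, rfl⟩ hxy
    have h1 : (⟨x - y, sub_mem hx hy⟩ : X') ∈ f (m + 1) := by
      simp only [f, OrderHom.coe_mk, LinearMap.mem_ker, LinearMap.comp_apply]
      rw [pow_succ']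
      refine (congrArg L (map_sub (L ^ m) x y)).trans ?_
      rw [map_sub]
      exact sub_eq_zero.2 hxy
    rw [← hn (m + 1) (by omega), hn m hm] at h1
    have h2 : (L ^ m) (x - y) = 0 := h1
    rwa [map_sub, sub_eq_zero] at h2
  have h0 := Nat.sInf_mem hne
  rw [eta] at h
  rw [h] at h0
  have := h0 0 le_rfl
  rwa [pow_zero, show (1 : AddMonoid.End G) = AddMonoidHom.id G from rfl,
    AddSubgroup.map_id] at this

end General

section Radical

variable {k : Type u} [Field k] {V E : Type u} [Fintype V] [DecidableEq V] {s t : E → V} {m : ℕ}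
  {X Y : Type*} [AddCommGroup X] [AddCommGroup Y]
  [Module (TruncOp k s t m) X] [Module (TruncOp k s t m) Y]

variable (k s t m X) in
/-- The radical of a module, generated by the images of the arrows. -/
def rad : Submodule (TruncOp k s t m) X where
  __ := AddSubmonoid.closure {y : X | ∃ a x, arrow k s t m a • x = y}
  smul_mem' r := by
    have key : ∀ r : TruncOp k s t m, (∀ a (x : X), r • arrow k s t m a • x ∈
        AddSubmonoid.closure {y : X | ∃ a x, arrow k s t m a • x = y}) → ∀ y ∈
        AddSubmonoid.closure {y : X | ∃ a x, arrow k s t m a • x = y}, r • y ∈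
        AddSubmonoid.closure {y : X | ∃ a x, arrow k s t m a • x = y} := by
      intro r hr y hy
      induction hy using AddSubmonoid.closure_induction with
      | mem y hy =>
        obtain ⟨a, x, rfl⟩ := hy
        exact hr a x
      | zero => simp
      | add y z _ _ hy hz => rw [smul_add]; exact add_mem hy hz
    induction r using truncOp_induction with
    | scalar c =>
      refine fun {y} => key _ (fun a x => AddSubmonoid.subset_closure
        ⟨a, algebraMap k (TruncOp k s t m) c • x, ?_⟩) y
      rw [smul_smul, smul_smul, Algebra.commutes]
    | vertex v =>
      refine fun {y} => key _ (fun a x => ?_) y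
      by_cases h : v = t a
      · rw [smul_smul, h, vertexIdem_mul_arrow]
        exact AddSubmonoid.subset_closure ⟨a, x, rfl⟩
      · rw [smul_smul, vertexIdem_mul_arrow_of_ne k s t m h, zero_smul]
        exact zero_mem _
    | arrow a => exact fun {y} _ => AddSubmonoid.subset_closure ⟨a, y, rfl⟩
    | mul r r' hr hr' => exact fun {y} hy => by rw [mul_smul]; exact hr (hr' hy)
    | add r r' hr hr' =>
      exact fun {y} hy => by rw [add_smul]; exact AddSubmonoid.add_mem _ (hr hy) (hr' hy)

lemma arrow_smul_mem_rad (a : E) (x : X) : arrow k s t m a • x ∈ rad k s t m X :=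
  AddSubmonoid.subset_closure ⟨a, x, rfl⟩

lemma rad_induction {motive : ∀ x : X, x ∈ rad k s t m X → Prop} (zero : motive 0 (zero_mem _))
    (add : ∀ y z hy hz, motive y hy → motive z hz → motive (y + z) (add_mem hy hz))
    (arrow : ∀ a x, motive (arrow k s t m a • x) (arrow_smul_mem_rad a x)) {x : X}
    (hx : x ∈ rad k s t m X) : motive x hx := by
  induction hx using AddSubmonoid.closure_induction with
  | mem y hy =>
    obtain ⟨a, x, rfl⟩ := hy
    exact arrow a x
  | zero => exact zero
  | add y z hy' hz' hy hz => exact add y z hy' hz' hy hz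

lemma map_mem_rad (f : X →ₗ[TruncOp k s t m] Y) {x : X} (hx : x ∈ rad k s t m X) :
    f x ∈ rad k s t m Y := by
  induction hx using rad_induction with
  | zero => simp
  | add y z _ _ hy hz => rw [map_add]; exact add_mem hy hz
  | arrow a x => rw [map_smul]; exact arrow_smul_mem_rad a _

/-- Nakayama's lemma. -/
lemma eq_top_of_sup_rad {N : Submodule (TruncOp k s t m) X} (h : N ⊔ rad k s t m X = ⊤) :
    N = ⊤ := by
  suffices H : ∀ j l, l + j = m → ∀ (x : X) (p : List E), p.length = l →
      arrowProd k s t m p • x ∈ N from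
    eq_top_iff.2 fun x _ => by simpa using H m 0 (by simp) x [] rfl
  intro j
  induction j with
  | zero =>
    intro l hl x p hp
    rw [arrowProd_of_length_eq k s t m (hp.trans hl), zero_smul]
    exact zero_mem _
  | succ j ih =>
    intro l hl x p hp
    obtain ⟨y, hy, z, hz, rfl⟩ := Submodule.mem_sup.1
      (h ▸ Submodule.mem_top : x ∈ N ⊔ rad k s t m X)
    rw [smul_add]
    refine add_mem (N.smul_mem _ hy) ?_
    induction hz using rad_induction with
    | zero => simp
    | add y z _ _ hy hz => rw [smul_add]; exact add_mem hy hz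
    | arrow a x =>
      have := ih (l + 1) (by omega) x (p ++ [a]) (by simp [hp])
      simpa [arrowProd_append, mul_smul] using this

end Radical

namespace PathMod

variable {k : Type u} [Field k] {V E : Type u} [Fintype V] [DecidableEq V] {s t : E → V} {m : ℕ}
  {I : Type u} {b : I → V} {r : ℕ}

lemma mem_of_coef (N : Submodule (TruncOp k s t m) (PathMod k s t m b r)) {z : PathMod k s t m b r}
    (h : ∀ i p, coef k s t m b r i p z ≠ 0 → bas k s t m b r i p ∈ N) : z ∈ N := by
  have key : z = ∑ y ∈ Finsupp.support z, coord k s t m b r y z • bas k s t m b r y.1.1 y.1.2 := by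
    refine (Finsupp.sum_single z).symm.trans (Finset.sum_congr rfl fun y _ => ?_)
    rw [bas_of y.2, ← map_smul, smul_eq_mul, mul_one]
    rfl
  rw [key]
  refine sum_mem fun y hy => ?_
  rw [← algebraMap_smul]
  refine N.smul_mem _ (h _ _ ?_)
  rw [coef_of y.2]
  exact Finsupp.mem_support_iff.1 hy

omit [Fintype V] [DecidableEq V] in
lemma isBasisPath_of_coef_ne_zero {i : I} {p : List E} {z : PathMod k s t m b r}
    (h : coef k s t m b r i p z ≠ 0) : IsBasisPath s t m b r (i, p) := by
  by_contra h'
  rw [coef_of_not h'] at h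
  exact h rfl

lemma coef_nil_of_mem_rad {z : PathMod k s t m b r} (hz : z ∈ rad k s t m (PathMod k s t m b r))
    (i : I) : coef k s t m b r i [] z = 0 := by
  induction hz using rad_induction with
  | zero => simp
  | add y z _ _ hy hz => rw [map_add, hy, hz, add_zero]
  | arrow a x => exact coef_arrow_smul_nil a x i

lemma bas_mem_rad (i : I) {p : List E} (hp : p ≠ []) :
    bas k s t m b r i p ∈ rad k s t m (PathMod k s t m b r) := by
  cases p with
  | nil => exact absurd rfl hp
  | cons a p =>
    rw [← arrow_smul_bas]
    exact arrow_smul_mem_rad _ _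

lemma mem_rad_iff {z : PathMod k s t m b r} :
    z ∈ rad k s t m (PathMod k s t m b r) ↔ ∀ i, coef k s t m b r i [] z = 0 := by
  refine ⟨coef_nil_of_mem_rad, fun h => mem_of_coef _ fun i p hp => bas_mem_rad i ?_⟩
  rintro rfl
  exact hp (h i)

lemma eq_top_of_bas (N : Submodule (TruncOp k s t m) (PathMod k s t m b r))
    (h : ∀ i, bas k s t m b r i [] ∈ N) : N = ⊤ :=
  eq_top_iff.2 fun z _ => mem_of_coef N fun i p _ => by
    rw [bas_eq]
    exact N.smul_mem _ (h i)

instance [Finite I] [Finite E] : Module.Finite k (PathMod k s t m b r) := by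
  have : Finite {l : List E // l.length < r} := List.finite_length_lt E r
  have : Finite {x : I × List E // IsBasisPath s t m b r x} :=
    Finite.of_injective (β := I × {l : List E // l.length < r})
      (fun x => (x.1.1, ⟨x.1.2, x.2.2.1⟩)) fun x y h => by
        simpa [Prod.ext_iff, Subtype.ext_iff] using h
  exact inferInstanceAs (Module.Finite k ({x : I × List E // IsBasisPath s t m b r x} →₀ k))

instance [Finite I] [Finite E] : IsNoetherian (TruncOp k s t m) (PathMod k s t m b r) :=
  isNoetherian_of_tower k inferInstance

instance [Finite I] [Finite E] : IsArtinian (TruncOp k s t m) (PathMod k s t m b r) :=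
  isArtinian_of_tower k inferInstance

/-- Path modules are projective among the modules annihilated by paths of length `r`. -/
lemma exists_lift {X Y : Type*} [AddCommGroup X] [AddCommGroup Y]
    [Module (TruncOp k s t m) X] [Module (TruncOp k s t m) Y]
    (f : X →ₗ[TruncOp k s t m] Y) (hf : Surjective f)
    (hX : ∀ (x : X) (p : List E), p.length = r → arrowProd k s t m p • x = 0)
    (g : PathMod k s t m b r →ₗ[TruncOp k s t m] Y) :
    ∃ h : PathMod k s t m b r →ₗ[TruncOp k s t m] X, ∀ z, f (h z) = g z := by
  choose x hx using fun i => hf (g (bas k s t m b r i []))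
  refine ⟨lift (fun i => vertexIdem k s t m (b i) • x i)
    (fun i => by rw [smul_smul, vertexIdem_mul_vertexIdem, if_pos rfl])
    (fun i p hp => hX _ p hp), LinearMap.congr_fun (f := f.comp _) (hom_ext fun i => ?_)⟩
  rw [LinearMap.comp_apply, lift_bas, arrowProd_nil, one_smul, map_smul, hx, ← map_smul,
    vertexIdem_smul_bas, endVertex, if_pos rfl]

instance : Module.Projective (TruncOp k s t m) (PathMod k s t m b m) :=
  Module.Projective.of_lifting_property'' fun f hf => by
    obtain ⟨h, hh⟩ := exists_lift (X := PathMod k s t m b m →₀ TruncOp k s t m) f hf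
      (fun x p hp => by rw [arrowProd_of_length_eq k s t m hp]; exact zero_smul _ x) LinearMap.id
    exact ⟨h, LinearMap.ext hh⟩

section cover

variable {X : Type*} [AddCommGroup X] [Module (TruncOp k s t m) X]

lemma exists_surjective [Module.Finite (TruncOp k s t m) X]
    (hX : ∀ (x : X) (p : List E), p.length = r → arrowProd k s t m p • x = 0) :
    ∃ (I : Type u) (_ : Fintype I) (b : I → V)
      (f : PathMod k s t m b r →ₗ[TruncOp k s t m] X), Surjective f := by
  obtain ⟨n, x, hx⟩ := Module.Finite.exists_fin (R := TruncOp k s t m) (M := X)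
  refine ⟨ULift.{u} (Fin n) × V, inferInstance, Prod.snd,
    lift (fun i => vertexIdem k s t m i.2 • x i.1.down)
      (fun i => by rw [smul_smul, vertexIdem_mul_vertexIdem, if_pos rfl])
      (fun i p hp => hX _ p hp), ?_⟩
  rw [← LinearMap.range_eq_top, eq_top_iff, ← hx, Submodule.span_le]
  rintro _ ⟨i, rfl⟩
  rw [← one_smul (TruncOp k s t m) (x i), ← sum_vertexIdem, Finset.sum_smul]
  refine sum_mem fun v _ => ⟨bas k s t m _ r (⟨i⟩, v) [], ?_⟩
  rw [lift_bas, arrowProd_nil, one_smul]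

/-- Existence of projective covers, relative to the modules annihilated by paths of length `r`. -/
lemma exists_cover [Module.Finite (TruncOp k s t m) X]
    (hX : ∀ (x : X) (p : List E), p.length = r → arrowProd k s t m p • x = 0) :
    ∃ (I : Type u) (_ : Fintype I) (b : I → V)
      (f : PathMod k s t m b r →ₗ[TruncOp k s t m] X),
      Surjective f ∧ LinearMap.ker f ≤ rad k s t m (PathMod k s t m b r) := by
  classical
  have hne : ∃ n, ∃ (I : Type u) (_ : Fintype I) (b : I → V)
      (f : PathMod k s t m b r →ₗ[TruncOp k s t m] X), Surjective f ∧ Fintype.card I = n := by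
    obtain ⟨I, hI, b, f, hf⟩ := exists_surjective hX
    exact ⟨_, I, hI, b, f, hf, rfl⟩
  obtain ⟨I, hI, b, f, hf, hn⟩ := Nat.find_spec hne
  refine ⟨I, hI, b, f, hf, fun z hz => mem_rad_iff.2 fun i => ?_⟩
  by_contra hi
  let g : PathMod k s t m (fun j : {j // j ≠ i} => b j) r →ₗ[TruncOp k s t m] X :=
    lift (fun j => f (bas k s t m b r j []))
      (fun j => by rw [← map_smul, vertexIdem_smul_bas, endVertex, if_pos rfl])
      (fun j p hp => hX _ p hp)
  refine Nat.find_min hne (m := Fintype.card {j // j ≠ i}) ?_ ⟨{j // j ≠ i}, inferInstance,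
    fun j => b j, g, ?_, rfl⟩
  · rw [← hn]
    exact Fintype.card_subtype_lt (x := i) (by simp)
  rw [← LinearMap.range_eq_top]
  refine eq_top_of_sup_rad ?_
  set N := LinearMap.range g ⊔ rad k s t m X with hN
  have hj (j) (hj : j ≠ i) : bas k s t m b r j [] ∈ N.comap f := by
    refine Submodule.mem_sup_left ⟨bas k s t m _ r ⟨j, hj⟩ [], ?_⟩
    rw [lift_bas, arrowProd_nil, one_smul]
  have hrad : rad k s t m (PathMod k s t m b r) ≤ N.comap f :=
    fun z hz => Submodule.mem_sup_right (map_mem_rad f hz)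
  have hker : LinearMap.ker f ≤ N.comap f := fun z hz => by
    rw [Submodule.mem_comap, LinearMap.mem_ker.1 hz]
    exact zero_mem _
  have hi' : bas k s t m b r i [] ∈ N.comap f := by
    set c := coef k s t m b r i [] z
    have h1 : z - c • bas k s t m b r i [] ∈ N.comap f := by
      refine mem_of_coef _ fun j p hp => ?_
      by_cases hp' : p = []
      · subst hp'
        refine hj j ?_
        rintro rfl
        rw [map_sub, map_smul, coef_bas, if_pos ⟨rfl, isBasisPath_of_coef_ne_zero hi⟩] at hp
        exact hp (by simp [c])
      · exact hrad (bas_mem_rad j hp')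
    have h2 := (Submodule.sub_mem_iff_right _ (hker hz)).1 h1
    have h3 := (N.comap f).smul_mem (algebraMap k _ c⁻¹) h2
    rwa [algebraMap_smul, smul_smul, inv_mul_cancel₀ hi, one_smul] at h3
  have htop : N.comap f = ⊤ := eq_top_of_bas _ fun j => by
    by_cases h : j = i
    · rwa [h]
    · exact hj j h
  rw [eq_top_iff]
  intro x _
  obtain ⟨z, rfl⟩ := hf x
  exact (htop ▸ Submodule.mem_top : z ∈ N.comap f)

end cover

end PathMod

namespace PathMod

section Syzygy

variable {k : Type u} [Field k] {V E : Type u} [Fintype V] [DecidableEq V] {s t : E → V} {m : ℕ}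
  {I : Type u} {b : I → V} {r : ℕ}

variable (s t b) in
/-- The pairs of an index `i` and a path of length `d` starting at `b i`. -/
abbrev ShiftIndex (d : ℕ) : Type u := {x : I × List E // IsPath s t (b x.1) x.2 ∧ x.2.length = d}

instance [Finite I] [Finite E] (d : ℕ) : Finite (ShiftIndex s t b d) :=
  have : Finite {l : List E // l.length = d} := List.finite_length_eq E d
  Finite.of_injective (β := I × {l : List E // l.length = d})
    (fun x => (x.1.1, ⟨x.1.2, x.2.2⟩)) fun x y h => by
      simpa [Prod.ext_iff, Subtype.ext_iff] using h

variable (s t b) in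
/-- The end vertices of the paths of length `d`. -/
def shift (d : ℕ) (x : ShiftIndex s t b d) : V := endVertex t (b x.1.1) x.1.2

variable (k s t m b) in
/-- The embedding of the paths of length at least `d` into all paths. -/
noncomputable def shiftHom (d : ℕ) (hd : d ≤ m) :
    PathMod k s t m (shift s t b d) (m - d) →ₗ[TruncOp k s t m] PathMod k s t m b m :=
  lift (fun x => bas k s t m b m x.1.1 x.1.2)
    (fun x => by rw [vertexIdem_smul_bas, shift, if_pos rfl])
    (fun x p hp => by
      rw [arrowProd_smul_bas, bas_of_not fun h => ?_]
      have h1 := h.2.1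
      have h2 := x.2.2
      simp at h1
      omega)

lemma shiftHom_bas {d : ℕ} (hd : d ≤ m) (x : ShiftIndex s t b d) (p : List E) :
    shiftHom k s t m b d hd (bas k s t m _ _ x p) = bas k s t m b m x.1.1 (p ++ x.1.2) := by
  rw [shiftHom, lift_bas, arrowProd_smul_bas]

omit [Fintype V] [DecidableEq V] in
lemma isBasisPath_shift_iff {d : ℕ} (hd : d ≤ m) (x : ShiftIndex s t b d) (p : List E) :
    IsBasisPath s t m (shift s t b d) (m - d) (x, p) ↔
      IsBasisPath s t m b m (x.1.1, p ++ x.1.2) := by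
  have h := x.2
  simp only [IsBasisPath, isPath_append, shift, List.length_append, h.1, h.2, and_true]
  refine and_congr_right fun _ => ?_
  omega

lemma coef_shiftHom {d : ℕ} (hd : d ≤ m) (x : ShiftIndex s t b d) (p : List E)
    (z : PathMod k s t m (shift s t b d) (m - d)) :
    coef k s t m b m x.1.1 (p ++ x.1.2) (shiftHom k s t m b d hd z) =
      coef k s t m _ _ x p z := by
  classical
  induction z using PathMod.induction with
  | zero => simp
  | add y z hy hz => rw [map_add, map_add, hy, hz, map_add]
  | bas c y q =>
    rw [← algebraMap_smul, map_smul, algebraMap_smul, algebraMap_smul, map_smul, map_smul,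
      shiftHom_bas, coef_bas, coef_bas, isBasisPath_shift_iff hd]
    have : (y.1.1, q ++ y.1.2) = (x.1.1, p ++ x.1.2) ↔ (y, q) = (x, p) := by
      simp only [Subtype.ext_iff, Prod.ext_iff]
      constructor
      · rintro ⟨h1, h2⟩
        obtain ⟨h3, h4⟩ := List.append_inj' h2 (y.2.2.trans x.2.2.symm)
        exact ⟨⟨h1, h4⟩, h3⟩
      · rintro ⟨⟨h1, h2⟩, h3⟩
        exact ⟨h1, by rw [h2, h3]⟩
    refine congrArg (c • ·) ?_
    simp only [this]
    split_ifs <;> rfl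

lemma shiftHom_injective {d : ℕ} (hd : d ≤ m) : Injective (shiftHom k s t m b d hd) := by
  intro y z h
  refine coef_ext fun x p => ?_
  rw [← coef_shiftHom hd, h, coef_shiftHom]

lemma mem_range_shiftHom {d : ℕ} (hd : d ≤ m) {z : PathMod k s t m b m} :
    z ∈ LinearMap.range (shiftHom k s t m b d hd) ↔
      ∀ i p, p.length < d → coef k s t m b m i p z = 0 := by
  classical
  constructor
  · rintro ⟨z, rfl⟩ i p hp
    induction z using PathMod.induction with
    | zero => simp
    | add y z hy hz => rw [map_add, map_add, hy, hz, add_zero]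
    | bas c y q =>
      rw [← algebraMap_smul, map_smul, algebraMap_smul, map_smul, shiftHom_bas, coef_bas, if_neg,
        smul_zero]
      rintro ⟨h, -⟩
      have := y.2.2
      rw [← (Prod.mk.inj h).2, List.length_append] at hp
      omega
  · intro h
    refine mem_of_coef _ fun i p hp => ?_
    obtain ⟨h1, -, -⟩ := isBasisPath_of_coef_ne_zero hp
    have h2 : d ≤ p.length := not_lt.1 fun h' => hp (h i p h')
    rw [← List.take_append_drop (p.length - d) p] at h1 ⊢
    refine ⟨bas k s t m _ _ ⟨(i, p.drop (p.length - d)), ((isPath_append ..).1 h1).2, ?_⟩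
      (p.take (p.length - d)), shiftHom_bas ..⟩
    simp
    omega

variable (k s t m b r) in
/-- The projection from the free path module. -/
noncomputable def proj : PathMod k s t m b m →ₗ[TruncOp k s t m] PathMod k s t m b r :=
  lift (fun i => bas k s t m b r i [])
    (fun i => by rw [vertexIdem_smul_bas, endVertex, if_pos rfl])
    (fun i p hp => by rw [arrowProd_of_length_eq k s t m hp, zero_smul])

lemma proj_bas (i : I) (p : List E) :
    proj k s t m b r (bas k s t m b m i p) = bas k s t m b r i p := by
  rw [proj, lift_bas, ← bas_eq]

lemma proj_surjective : Surjective (proj k s t m b r) := by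
  rw [← LinearMap.range_eq_top]
  exact eq_top_of_bas _ fun i => ⟨_, proj_bas i []⟩

lemma coef_proj (i : I) (p : List E) (z : PathMod k s t m b m) :
    coef k s t m b r i p (proj k s t m b r z) =
      if p.length < r then coef k s t m b m i p z else 0 := by
  classical
  induction z using PathMod.induction with
  | zero => simp
  | add y z hy hz =>
    rw [map_add, map_add, hy, hz, map_add]
    split_ifs <;> simp
  | bas c j q =>
    rw [← algebraMap_smul, map_smul, algebraMap_smul, algebraMap_smul, map_smul, map_smul,
      proj_bas, coef_bas, coef_bas]
    by_cases h : p.length < r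
    · simp [IsBasisPath, h]
    · rw [if_neg h, if_neg fun h' => h h'.2.2.1, smul_zero]

lemma ker_proj (hr : r ≤ m) :
    LinearMap.ker (proj k s t m b r) = LinearMap.range (shiftHom k s t m b r hr) := by
  ext z
  rw [mem_range_shiftHom, LinearMap.mem_ker]
  constructor
  · intro h i p hp
    have := coef_proj i p z (r := r)
    rwa [h, if_pos hp, map_zero, eq_comm] at this
  · intro h
    refine coef_ext fun i p => ?_
    rw [coef_proj, map_zero]
    split_ifs with h'
    exacts [h i p h', rfl]

lemma ker_proj_le_rad (hr : 0 < r) :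
    LinearMap.ker (proj k s t m b r) ≤ rad k s t m (PathMod k s t m b m) := by
  intro z hz
  refine mem_rad_iff.2 fun i => ?_
  have := coef_proj i [] z (r := r)
  rwa [LinearMap.mem_ker.1 hz, if_pos (by simpa using hr), map_zero, eq_comm] at this

end Syzygy

section Component

variable {k : Type u} [Field k] {V E : Type u} [Fintype V] [DecidableEq V] {s t : E → V} {m : ℕ}
  {I : Type u} {b : I → V} {r : ℕ}

variable (k s t m r) in
/-- The module `e_v A / e_v J^r`. -/
abbrev VertexMod (v : V) : Type u := PathMod k s t m (fun _ : PUnit.{u + 1} => v) r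

variable (k s t m b r) in
open Classical in
/-- The projection to one summand. -/
noncomputable def compProj (i : I) :
    PathMod k s t m b r →ₗ[TruncOp k s t m] VertexMod k s t m r (b i) :=
  lift (fun j => if j = i then bas k s t m _ r PUnit.unit [] else 0)
    (fun j => by
      by_cases h : j = i
      · subst h
        rw [if_pos rfl, vertexIdem_smul_bas, endVertex, if_pos rfl]
      · rw [if_neg h, smul_zero])
    (fun j p hp => arrowProd_smul hp _)

variable (k s t m b r) in
/-- The inclusion of one summand. -/
noncomputable def compIncl (i : I) :
    VertexMod k s t m r (b i) →ₗ[TruncOp k s t m] PathMod k s t m b r :=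
  lift (fun _ => bas k s t m _ r i [])
    (fun _ => by rw [vertexIdem_smul_bas, endVertex, if_pos rfl])
    (fun _ p hp => arrowProd_smul hp _)

lemma coef_compProj (i : I) (p : List E) (z : PathMod k s t m b r) :
    coef k s t m _ r PUnit.unit p (compProj k s t m b r i z) = coef k s t m b r i p z := by
  classical
  induction z using PathMod.induction with
  | zero => simp
  | add y z hy hz => rw [map_add, map_add, hy, hz, map_add]
  | bas c j q =>
    rw [← algebraMap_smul, map_smul, algebraMap_smul, algebraMap_smul, map_smul, map_smul,
      compProj, lift_bas, coef_bas]
    by_cases h : j = i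
    · subst h
      rw [if_pos rfl, ← bas_eq, coef_bas]
      simp [IsBasisPath]
    · simp [h]

lemma compProj_compIncl (i : I) (x : VertexMod k s t m r (b i)) :
    compProj k s t m b r i (compIncl k s t m b r i x) = x := by
  refine LinearMap.congr_fun (f := (compProj k s t m b r i).comp (compIncl k s t m b r i))
    (g := LinearMap.id) (hom_ext fun _ => ?_) x
  rw [LinearMap.comp_apply, compIncl, lift_bas, arrowProd_nil, one_smul, compProj, lift_bas,
    arrowProd_nil, one_smul, if_pos rfl]
  rfl

lemma compProj_compIncl_of_ne {i j : I} (h : j ≠ i) (x : VertexMod k s t m r (b j)) :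
    compProj k s t m b r i (compIncl k s t m b r j x) = 0 := by
  refine LinearMap.congr_fun (f := (compProj k s t m b r i).comp (compIncl k s t m b r j))
    (g := 0) (hom_ext fun _ => ?_) x
  rw [LinearMap.comp_apply, compIncl, lift_bas, arrowProd_nil, one_smul, compProj, lift_bas,
    arrowProd_nil, one_smul, if_neg h]
  rfl

/-- A path module is the direct sum of its components. -/
lemma pi_compProj_bijective {n : ℕ} (e : Fin n ≃ I) :
    Bijective (LinearMap.pi fun i => compProj k s t m b r (e i)) := by
  classical
  constructor
  · intro y z h
    refine coef_ext fun i p => ?_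
    have := congrFun h (e.symm i)
    simp only [LinearMap.pi_apply] at this
    rw [← e.apply_symm_apply i, ← coef_compProj, this, coef_compProj]
  · intro x
    refine ⟨∑ i, compIncl k s t m b r (e i) (x i), funext fun i => ?_⟩
    rw [LinearMap.pi_apply, map_sum, Finset.sum_eq_single i, compProj_compIncl]
    · intro j _ hj
      exact compProj_compIncl_of_ne (e.injective.ne hj) _
    · simp

/-- A submodule of a path module which is not contained in the radical has a summand
`e_v A / e_v J^r`. -/
lemma exists_section_of_not_mem_rad (N : Submodule (TruncOp k s t m) (PathMod k s t m b r))
    {z : PathMod k s t m b r} (hz : z ∈ N) {i : I} (hi : coef k s t m b r i [] z ≠ 0) :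
    ∃ (σ : VertexMod k s t m r (b i) →ₗ[TruncOp k s t m] N)
      (π : N →ₗ[TruncOp k s t m] VertexMod k s t m r (b i)), ∀ x, π (σ x) = x := by
  set π := (compProj k s t m b r i).comp N.subtype with hπ
  have h1 : compProj k s t m b r i z ∈ LinearMap.range π := ⟨⟨z, hz⟩, rfl⟩
  have surj : Surjective π := by
    rw [← LinearMap.range_eq_top]
    refine eq_top_of_sup_rad (eq_top_of_bas _ fun _ => ?_)
    set c := coef k s t m b r i [] z
    have h2 : compProj k s t m b r i z - c • bas k s t m _ r PUnit.unit [] ∈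
        rad k s t m (VertexMod k s t m r (b i)) := by
      refine mem_rad_iff.2 fun _ => ?_
      have hb : IsBasisPath s t m (fun _ : PUnit.{u + 1} => b i) r (PUnit.unit, []) :=
        ⟨trivial, (isBasisPath_of_coef_ne_zero hi).2⟩
      rw [map_sub, map_smul, coef_compProj, coef_bas, if_pos ⟨rfl, hb⟩]
      simp [c]
    have h3 := (Submodule.sub_mem_iff_right _ (Submodule.mem_sup_left h1)).1
      (Submodule.mem_sup_right (S := LinearMap.range π) h2)
    have h4 := Submodule.smul_mem _ (algebraMap k (TruncOp k s t m) c⁻¹) h3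
    rwa [algebraMap_smul, smul_smul, inv_mul_cancel₀ hi, one_smul] at h4
  obtain ⟨σ, hσ⟩ := exists_lift π surj
    (fun x p hp => Subtype.ext ((N.coe_smul _ x).trans (arrowProd_smul hp x.1))) LinearMap.id
  exact ⟨σ, π, hσ⟩

end Component

end PathMod

section Objects

open PathMod

variable (k : Type u) [Field k] {V E : Type u} [Fintype V] [DecidableEq V] [Finite E]
  (s t : E → V) (m : ℕ) {I : Type u} (b : I → V) (r : ℕ)

/-- A path module as an object of the category of finitely generated modules. -/
noncomputable def pathObj [Finite I] : FGMod (TruncOp k s t m) := ⟨PathMod k s t m b r⟩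

/-- The module `e_v A / e_v J^r` as an object of the category of finitely generated modules. -/
noncomputable abbrev vertexObj (v : V) : FGMod (TruncOp k s t m) :=
  pathObj k s t m (fun _ : PUnit.{u + 1} => v) r

variable {r}

/-- A surjection from a module `e A`, `e` idempotent, with kernel in the radical is a
projective cover. -/
lemma isProjCover_of_ker_le_rad [Finite I] {M : FGMod (TruncOp k s t m)}
    (f : PathMod k s t m b m →ₗ[TruncOp k s t m] M.carrier) (hf : Surjective f)
    (h : LinearMap.ker f ≤ rad k s t m (PathMod k s t m b m)) :
    IsProjCover (P := pathObj k s t m b m) f :=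
  ⟨inferInstanceAs (Module.Projective (TruncOp k s t m) (PathMod k s t m b m)), hf,
    fun N hN => eq_top_of_sup_rad (top_le_iff.1 (hN.symm.trans_le (sup_le_sup_left h N)))⟩

lemma isSyzygyOf_pathObj [Finite I] (hr : 0 < r) (hrm : r ≤ m) :
    IsSyzygyOf (pathObj k s t m (shift s t b r) (m - r)) (pathObj k s t m b r) :=
  ⟨pathObj k s t m b m, proj k s t m b r,
    isProjCover_of_ker_le_rad k s t m b (M := pathObj k s t m b r) _ proj_surjective
      (ker_proj_le_rad hr),
    ⟨(LinearEquiv.ofInjective _ (shiftHom_injective hrm)).trans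
      (LinearEquiv.ofEq _ _ (ker_proj hrm).symm)⟩⟩

lemma toK0_pathObj [Fintype I] :
    toK0 (pathObj k s t m b r) = ∑ i, toK0 (vertexObj k s t m r (b i)) := by
  let e := (Fintype.equivFin I).symm
  rw [← e.sum_comp, ← toK0_dsum]
  exact toK0_congr (N := dsum fun i => vertexObj k s t m r (b (e i)))
    (LinearEquiv.ofBijective _ (pi_compProj_bijective e))

lemma pathObj_mem_addOf [Fintype I] {C : Set (FGMod (TruncOp k s t m))}
    (h : ∀ i, vertexObj k s t m r (b i) ∈ C) : pathObj k s t m b r ∈ addOf C := by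
  let e := (Fintype.equivFin I).symm
  exact mem_addOf_of_equiv (X := pathObj k s t m b r)
    (f := fun i => vertexObj k s t m r (b (e i))) (fun i => h (e i))
    (LinearEquiv.ofBijective _ (pi_compProj_bijective e))

/-- Direct summands of path modules are path modules. -/
lemma exists_pathObj_equiv_of_isSummand [Finite I] {N : FGMod (TruncOp k s t m)}
    (h : IsSummand N (pathObj k s t m b r)) :
    ∃ (J : Type u) (_ : Fintype J) (c : J → V),
      Nonempty ((pathObj k s t m c r).carrier ≃ₗ[TruncOp k s t m] N.carrier) := by
  obtain ⟨σ, π, hσ⟩ := exists_section_of_isSummand h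
  obtain ⟨J, hJ, c, f, hf, hker⟩ := exists_cover (k := k) (s := s) (t := t) (r := r)
    (X := N.carrier) fun x p hp => by
      rw [← hσ x, ← map_smul]
      exact (congrArg π (arrowProd_smul hp (σ x))).trans (map_zero π)
  obtain ⟨h, hh⟩ := exists_lift (b := b) f hf (fun x p hp => arrowProd_smul hp x) π
  refine ⟨J, hJ, c, ⟨LinearEquiv.ofBijective f ⟨?_, hf⟩⟩⟩
  have hfg (x) : f (h (σ x)) = x := (hh _).trans (hσ x)
  have hg : LinearMap.range (h.comp σ) = ⊤ := by
    refine eq_top_of_sup_rad (top_le_iff.1 ((eq_top_iff.2 fun z _ => ?_).symm.trans_le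
      (sup_le_sup_left hker _)))
    refine Submodule.mem_sup.2 ⟨h (σ (f z)), ⟨_, rfl⟩, z - h (σ (f z)), ?_, by simp⟩
    rw [LinearMap.mem_ker, map_sub, hfg, sub_self]
  intro y z hyz
  obtain ⟨y, rfl⟩ := LinearMap.range_eq_top.1 hg y
  obtain ⟨z, rfl⟩ := LinearMap.range_eq_top.1 hg z
  exact congrArg (fun x => h (σ x)) ((hfg y).symm.trans (hyz.trans (hfg z)))

lemma isSummand_vertexObj [Finite I] (i : I) :
    IsSummand (vertexObj k s t m r (b i)) (pathObj k s t m b r) :=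
  isSummand_of_section (X := vertexObj k s t m r (b i)) (Y := pathObj k s t m b r)
    (compIncl k s t m b r i) (compProj k s t m b r i) (compProj_compIncl i)

lemma grpOf_pathObj : grpOf {pathObj k s t m (id : V → V) r} =
    AddSubgroup.closure (Set.range fun v => toK0 (vertexObj k s t m r v)) := by
  refine le_antisymm ((AddSubgroup.closure_le _).2 ?_) ((AddSubgroup.closure_le _).2 ?_)
  · rintro _ ⟨N, M, hM, hN, rfl⟩
    rw [Set.mem_singleton_iff.1 hM] at hN
    obtain ⟨J, _, c, ⟨e⟩⟩ := exists_pathObj_equiv_of_isSummand k s t m _ hN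
    rw [← toK0_congr e, toK0_pathObj]
    exact sum_mem fun i _ => AddSubgroup.subset_closure ⟨_, rfl⟩
  · rintro _ ⟨v, rfl⟩
    exact AddSubgroup.subset_closure ⟨_, _, rfl, isSummand_vertexObj k s t m id v, rfl⟩

lemma grpOf_pathObj_fg : (grpOf {pathObj k s t m (id : V → V) r}).FG := by
  rw [grpOf_pathObj, AddSubgroup.fg_iff]
  exact ⟨_, rfl, Set.finite_range _⟩

end Objects

lemma length_of_equiv_prod {S : Type*} [Ring S] {X Y Z : Type*} [AddCommGroup X] [AddCommGroup Y]
    [AddCommGroup Z] [Module S X] [Module S Y] [Module S Z] (e : X ≃ₗ[S] Y × Z)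
    {p : Submodule S X} {q : Submodule S Y} {q' : Submodule S Z}
    (h : ∀ x, x ∈ p ↔ (e x).1 ∈ q ∧ (e x).2 ∈ q') :
    Module.length S p = Module.length S q + Module.length S q' := by
  rw [← Module.length_prod]
  refine LinearEquiv.length_eq (LinearEquiv.ofBijective
    ((((LinearMap.fst S Y Z).comp e.toLinearMap).restrict fun x hx => ((h x).1 hx).1).prod
      (((LinearMap.snd S Y Z).comp e.toLinearMap).restrict fun x hx => ((h x).1 hx).2)) ⟨?_, ?_⟩)
  · intro x y hxy
    exact Subtype.ext (e.injective (Prod.ext (congrArg (fun z => (z.1 : Y)) hxy)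
      (congrArg (fun z => (z.2 : Z)) hxy)))
  · rintro ⟨y, z⟩
    refine ⟨⟨e.symm (y, z), (h _).2 (by simp)⟩, ?_⟩
    exact Prod.ext (Subtype.ext (congrArg Prod.fst (e.apply_symm_apply ((y : Y), (z : Z)))))
      (Subtype.ext (congrArg Prod.snd (e.apply_symm_apply ((y : Y), (z : Z)))))

section Invariant

open PathMod

variable {k : Type u} [Field k] {V E : Type u} [Fintype V] [DecidableEq V] {s t : E → V} {m : ℕ}
  {X Y Z : Type*} [AddCommGroup X] [AddCommGroup Y] [AddCommGroup Z]
  [Module (TruncOp k s t m) X] [Module (TruncOp k s t m) Y] [Module (TruncOp k s t m) Z]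

variable (k s t m X) in
/-- The elements generating a submodule annihilated by the paths of length `r`. -/
def pathTorsion (r : ℕ) : Submodule (TruncOp k s t m) X where
  carrier := {x | ∀ (c : TruncOp k s t m) (p : List E), p.length = r →
    arrowProd k s t m p • c • x = 0}
  zero_mem' := by simp
  add_mem' hx hy c p hp := by rw [smul_add, smul_add, hx c p hp, hy c p hp, add_zero]
  smul_mem' c' x hx c p hp := by rw [smul_smul c]; exact hx _ p hp

variable (k s t m X) in
/-- The largest submodule whose component at the vertex `w` lies in the radical. -/
def vertexRad (w : V) : Submodule (TruncOp k s t m) X where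
  carrier := {x | ∀ c : TruncOp k s t m, vertexIdem k s t m w • c • x ∈ rad k s t m X}
  zero_mem' := by simp
  add_mem' hx hy c := by rw [smul_add, smul_add]; exact add_mem (hx c) (hy c)
  smul_mem' c' x hx c := by rw [smul_smul c]; exact hx _

lemma map_mem_pathTorsion (f : X →ₗ[TruncOp k s t m] Y) {r : ℕ} {x : X}
    (hx : x ∈ pathTorsion k s t m X r) : f x ∈ pathTorsion k s t m Y r := fun c p hp => by
  rw [← map_smul, ← map_smul, hx c p hp, map_zero]

lemma map_mem_vertexRad (f : X →ₗ[TruncOp k s t m] Y) {w : V} {x : X}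
    (hx : x ∈ vertexRad k s t m X w) : f x ∈ vertexRad k s t m Y w := fun c => by
  rw [← map_smul, ← map_smul]
  exact map_mem_rad f (hx c)

lemma rad_le_vertexRad (w : V) : rad k s t m X ≤ vertexRad k s t m X w :=
  fun _ hx _ => Submodule.smul_mem _ _ (Submodule.smul_mem _ _ hx)

lemma mem_pathTorsion_iff (e : X ≃ₗ[TruncOp k s t m] Y × Z) (r : ℕ) (x : X) :
    x ∈ pathTorsion k s t m X r ↔
      (e x).1 ∈ pathTorsion k s t m Y r ∧ (e x).2 ∈ pathTorsion k s t m Z r := by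
  constructor
  · exact fun hx => ⟨map_mem_pathTorsion ((LinearMap.fst _ Y Z).comp e.toLinearMap) hx,
      map_mem_pathTorsion ((LinearMap.snd _ Y Z).comp e.toLinearMap) hx⟩
  · intro hx
    have := add_mem (map_mem_pathTorsion (e.symm.toLinearMap.comp (LinearMap.inl _ Y Z)) hx.1)
      (map_mem_pathTorsion (e.symm.toLinearMap.comp (LinearMap.inr _ Y Z)) hx.2)
    simpa [← map_add] using this

lemma mem_vertexRad_iff (e : X ≃ₗ[TruncOp k s t m] Y × Z) (w : V) (x : X) :
    x ∈ vertexRad k s t m X w ↔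
      (e x).1 ∈ vertexRad k s t m Y w ∧ (e x).2 ∈ vertexRad k s t m Z w := by
  constructor
  · exact fun hx => ⟨map_mem_vertexRad ((LinearMap.fst _ Y Z).comp e.toLinearMap) hx,
      map_mem_vertexRad ((LinearMap.snd _ Y Z).comp e.toLinearMap) hx⟩
  · intro hx
    have := add_mem (map_mem_vertexRad (e.symm.toLinearMap.comp (LinearMap.inl _ Y Z)) hx.1)
      (map_mem_vertexRad (e.symm.toLinearMap.comp (LinearMap.inr _ Y Z)) hx.2)
    simpa [← map_add] using this

variable (k s t m X) in
/-- The length of the `w`-component of the top of `X` seen by `pathTorsion`. -/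
noncomputable def topLength (r : ℕ) (w : V) : ℤ :=
  (Module.length (TruncOp k s t m) (pathTorsion k s t m X r)).toNat -
    (Module.length (TruncOp k s t m)
      (pathTorsion k s t m X r ⊓ vertexRad k s t m X w : Submodule _ X)).toNat

lemma isNoetherian_isArtinian_of_finite [Finite E] [Module.Finite (TruncOp k s t m) X] :
    IsNoetherian (TruncOp k s t m) X ∧ IsArtinian (TruncOp k s t m) X := by
  obtain ⟨I, _, b, f, hf⟩ := exists_surjective (X := X) (r := m) fun x p hp => by
    rw [arrowProd_of_length_eq k s t m hp, zero_smul]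
  exact ⟨isNoetherian_of_surjective f (LinearMap.range_eq_top.2 hf),
    isArtinian_of_surjective _ f hf⟩

lemma topLength_of_equiv_prod [Finite E] [Module.Finite (TruncOp k s t m) X]
    [Module.Finite (TruncOp k s t m) Y] [Module.Finite (TruncOp k s t m) Z]
    (e : X ≃ₗ[TruncOp k s t m] Y × Z) (r : ℕ) (w : V) :
    topLength k s t m X r w = topLength k s t m Y r w + topLength k s t m Z r w := by
  obtain ⟨_, _⟩ := isNoetherian_isArtinian_of_finite (k := k) (s := s) (t := t) (m := m) (X := Y)
  obtain ⟨_, _⟩ := isNoetherian_isArtinian_of_finite (k := k) (s := s) (t := t) (m := m) (X := Z)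
  have h1 := length_of_equiv_prod e (mem_pathTorsion_iff e r)
  have h2 := length_of_equiv_prod e
    (p := pathTorsion k s t m X r ⊓ vertexRad k s t m X w)
    (q := pathTorsion k s t m Y r ⊓ vertexRad k s t m Y w)
    (q' := pathTorsion k s t m Z r ⊓ vertexRad k s t m Z w) fun x => by
      rw [Submodule.mem_inf, mem_pathTorsion_iff e, mem_vertexRad_iff e, Submodule.mem_inf,
        Submodule.mem_inf]
      tauto
  rw [topLength, h1, h2, ENat.toNat_add Module.length_ne_top Module.length_ne_top,
    ENat.toNat_add Module.length_ne_top Module.length_ne_top, topLength, topLength]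
  push_cast
  ring

lemma topLength_nonneg [Finite E] [Module.Finite (TruncOp k s t m) X] (r : ℕ) (w : V) :
    0 ≤ topLength k s t m X r w := by
  obtain ⟨_, _⟩ := isNoetherian_isArtinian_of_finite (k := k) (s := s) (t := t) (m := m) (X := X)
  rw [topLength, sub_nonneg, Nat.cast_le]
  exact ENat.toNat_le_toNat (Module.length_le_of_injective _
    (Submodule.inclusion_injective inf_le_left)) Module.length_ne_top

lemma topLength_eq_zero {r : ℕ} {w : V} (h : pathTorsion k s t m X r ≤ vertexRad k s t m X w) :
    topLength k s t m X r w = 0 := by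
  rw [topLength, inf_eq_left.2 h, sub_self]

lemma topLength_pathMod {I : Type u} {b : I → V} {r : ℕ} (hr : r < m)
    (hb : ∀ i, ∃ p, IsPath s t (b i) p ∧ p.length = r) (w : V) :
    topLength k s t m (PathMod k s t m b m) r w = 0 := by
  refine topLength_eq_zero (le_trans (fun z hz => mem_rad_iff.2 fun i => ?_) (rad_le_vertexRad w))
  obtain ⟨p, hp, rfl⟩ := hb i
  rw [← coef_arrowProd_smul z (p := p) ⟨hp, hr, hr⟩]
  have := hz 1 p rfl
  rw [one_smul] at this
  rw [this, map_zero]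

lemma topLength_of_projective [Finite E] [Module.Finite (TruncOp k s t m) X]
    [Module.Projective (TruncOp k s t m) X] {r : ℕ} (hr : r < m)
    (hb : ∀ v, ∃ p, IsPath s t v p ∧ p.length = r) (w : V) : topLength k s t m X r w = 0 := by
  obtain ⟨I, _, b, f, hf⟩ := exists_surjective (X := X) (r := m) fun x p hp => by
    rw [arrowProd_of_length_eq k s t m hp, zero_smul]
  obtain ⟨σ, hσ⟩ := Module.projective_lifting_property f LinearMap.id hf
  have hσ' := LinearMap.congr_fun hσ
  have := finite_ker_of_section σ f hσ'
  have h := topLength_of_equiv_prod (k := k) (s := s) (t := t) (m := m)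
    (X := PathMod k s t m b m) (Y := X) (Z := LinearMap.ker f) (splitEquiv σ f hσ') r w
  rw [topLength_pathMod hr (fun i => hb (b i))] at h
  have h1 := topLength_nonneg (k := k) (s := s) (t := t) (m := m) (X := X) r w
  have h2 := topLength_nonneg (k := k) (s := s) (t := t) (m := m) (X := LinearMap.ker f) r w
  omega

lemma topLength_vertexMod_of_ne {r : ℕ} {v w : V} (h : v ≠ w) :
    topLength k s t m (VertexMod k s t m r v) r w = 0 :=
  topLength_eq_zero fun z _ c => mem_rad_iff.2 fun i => by
    rw [coef_vertexIdem_smul, endVertex, if_neg h]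

lemma topLength_vertexMod_pos [Finite E] {r : ℕ} (hr : 0 < r) (hm : 0 < m) (w : V) :
    0 < topLength k s t m (VertexMod k s t m r w) r w := by
  have h1 : pathTorsion k s t m (VertexMod k s t m r w) r = ⊤ :=
    eq_top_iff.2 fun z _ c p hp => arrowProd_smul hp _
  have h2 : vertexRad k s t m (VertexMod k s t m r w) w ≠ ⊤ := by
    intro h
    have h3 := (h ▸ Submodule.mem_top :
      bas k s t m _ r PUnit.unit [] ∈ vertexRad k s t m (VertexMod k s t m r w) w) 1
    have h4 := mem_rad_iff.1 h3 PUnit.unit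
    rw [one_smul, vertexIdem_smul_bas, endVertex, if_pos rfl, coef_bas,
      if_pos ⟨rfl, trivial, hr, hm⟩] at h4
    exact one_ne_zero h4
  rw [topLength, h1, top_inf_eq, sub_pos, Nat.cast_lt, Module.length_top]
  have h3 := Submodule.length_lt h2
  rwa [← ENat.natCast_toNat (Module.length_ne_top (M := VertexMod k s t m r w)),
    ← ENat.natCast_toNat Module.length_ne_top, Nat.cast_lt] at h3

variable [Finite E] {r : ℕ} (hr : r < m) (hb : ∀ v, ∃ p, IsPath s t v p ∧ p.length = r)

include hr hb in
lemma exists_topLength_hom (w : V) : ∃ F : K0 (TruncOp k s t m) →+ ℤ,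
    ∀ M : FGMod (TruncOp k s t m), F (toK0 M) = topLength k s t m M.carrier r w := by
  let F := FreeAbelianGroup.lift fun M : FGMod (TruncOp k s t m) =>
    topLength k s t m M.carrier r w
  refine ⟨QuotientAddGroup.lift (K0Rels (TruncOp k s t m)) F ?_, fun M => ?_⟩
  · refine (AddSubgroup.closure_le F.ker).2 ?_
    rintro _ (⟨M, M', M'', ⟨e⟩, rfl⟩ | ⟨P, hP, rfl⟩)
    · simp only [SetLike.mem_coe, AddMonoidHom.mem_ker, map_sub, F, FreeAbelianGroup.lift_apply_of,
        topLength_of_equiv_prod e]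
      ring
    · have : Module.Projective (TruncOp k s t m) P.carrier := hP
      simp only [SetLike.mem_coe, AddMonoidHom.mem_ker, F, FreeAbelianGroup.lift_apply_of]
      exact topLength_of_projective hr hb w
  · exact (QuotientAddGroup.lift_mk _ _ _).trans (FreeAbelianGroup.lift_apply_of _ _)

include hb in
/-- The classes of the modules `e_v A / e_v J^r` are linearly independent in `K₀`. -/
lemma toK0_vertexObj_independent (hr0 : 0 < r) (hr : r < m) {c : V → ℤ}
    (h : ∑ v, c v • toK0 (vertexObj k s t m r v) = 0) (w : V) : c w = 0 := by
  obtain ⟨F, hF⟩ := exists_topLength_hom (k := k) hr hb w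
  have h1 := congrArg F h
  rw [map_sum, map_zero, Finset.sum_eq_single w, map_zsmul, hF, smul_eq_mul] at h1
  · exact (mul_eq_zero.1 h1).resolve_right (topLength_vertexMod_pos hr0 (by omega) w).ne'
  · intro v _ hv
    rw [map_zsmul, hF]
    exact (congrArg (c v • ·) (topLength_vertexMod_of_ne hv)).trans (smul_zero _)
  · simp

end Invariant

section Paths

variable {V E : Type u} {s t : E → V}

lemma exists_isPath_of_reflTransGen {v w : V}
    (h : Relation.ReflTransGen (fun a b => ∃ e : E, s e = a ∧ t e = b) v w) :
    ∃ p, IsPath s t v p ∧ endVertex t v p = w := by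
  induction h with
  | refl => exact ⟨[], trivial, rfl⟩
  | tail _ he ih =>
    obtain ⟨p, hp, rfl⟩ := ih
    obtain ⟨e, he, rfl⟩ := he
    exact ⟨e :: p, ⟨he, hp⟩, rfl⟩

lemma exists_isPath_length (h : ∀ v, ∃ e, s e = v) (v : V) (n : ℕ) :
    ∃ p, IsPath s t v p ∧ p.length = n := by
  induction n with
  | zero => exact ⟨[], trivial, rfl⟩
  | succ n ih =>
    obtain ⟨p, hp, rfl⟩ := ih
    obtain ⟨e, he⟩ := h (endVertex t v p)
    exact ⟨e :: p, ⟨he, hp⟩, rfl⟩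

lemma exists_source_eq (hsc : StronglyConnected V E s t) (e : E) (v : V) : ∃ e, s e = v := by
  obtain rfl | ⟨_, ⟨e, he, _⟩, _⟩ := (hsc v (s e)).cases_head
  exacts [⟨e, rfl⟩, ⟨e, he⟩]

lemma isPath_replicate {e : E} (he : s e = t e) (n : ℕ) :
    IsPath s t (t e) (List.replicate n e) ∧ endVertex t (t e) (List.replicate n e) = t e := by
  induction n with
  | zero => exact ⟨trivial, rfl⟩
  | succ n ih => exact ⟨⟨he.trans ih.2.symm, ih.1⟩, rfl⟩

lemma exists_isPath_length_mul (hsc : StronglyConnected V E s t) {e : E} (he : s e = t e)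
    {m : ℕ} (hm : 0 < m) (v w : V) :
    ∃ n p, IsPath s t v p ∧ p.length = m * n ∧ endVertex t v p = w := by
  obtain ⟨p, hp, hpe⟩ := exists_isPath_of_reflTransGen (hsc v (t e))
  obtain ⟨q, hq, hqe⟩ := exists_isPath_of_reflTransGen (hsc (t e) w)
  obtain ⟨h1, h2⟩ := isPath_replicate he ((m - 1) * (p.length + q.length))
  refine ⟨p.length + q.length, q ++ (List.replicate ((m - 1) * (p.length + q.length)) e ++ p),
    ?_, ?_, ?_⟩
  · rw [isPath_append, isPath_append, endVertex_append, hpe, h2]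
    exact ⟨hq, h1, hp⟩
  · obtain ⟨m, rfl⟩ := Nat.exists_eq_add_of_lt hm
    simp
    ring
  · rw [endVertex_append, endVertex_append, hpe, h2, hqe]

end Paths

section Counting

open PathMod

variable {V E : Type u} [Fintype V] [DecidableEq V] [Fintype E] {s t : E → V}

variable (s t) in
/-- The adjacency matrix with integral entries. -/
noncomputable def intAdj : Matrix V V ℤ := (adjMatrix V E s t).map (Nat.cast : ℕ → ℤ)

lemma sum_source_eq {G : Type*} [AddCommGroup G] (g : V → G) (v : V) :
    ∑ e : {e // s e = v}, g (t e) = ∑ w, intAdj s t v w • g w := by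
  classical
  rw [← Finset.sum_subtype (Finset.univ.filter fun e => s e = v) (by simp) fun e => g (t e),
    ← Finset.sum_fiberwise _ t]
  refine Finset.sum_congr rfl fun w _ => ?_
  rw [Finset.sum_congr rfl (g := fun _ => g w)
    fun e he => by rw [(Finset.mem_filter.1 he).2], Finset.sum_const, Finset.filter_filter,
    ← Fintype.card_subtype, ← Nat.card_eq_fintype_card, intAdj, Matrix.map_apply, natCast_zsmul]
  rfl

/-- The powers of the adjacency matrix count paths. -/
lemma sum_shift {G : Type*} [AddCommGroup G] {I : Type u} [Fintype I] (b : I → V) (d : ℕ)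
    [inst : Fintype (ShiftIndex s t b d)] (g : V → G) :
    ∑ x : ShiftIndex s t b d, g (shift s t b d x) = ∑ i, ∑ w, (intAdj s t ^ d) (b i) w • g w := by
  induction d generalizing g inst with
  | zero =>
    have h : Bijective fun i : I => (⟨(i, []), trivial, rfl⟩ : ShiftIndex s t b 0) := by
      constructor
      · intro i j h
        exact congrArg (fun x => x.1.1) h
      · rintro ⟨⟨i, p⟩, h, h'⟩
        obtain rfl := List.length_eq_zero_iff.1 h'
        exact ⟨i, rfl⟩
    rw [← h.sum_comp]
    refine Finset.sum_congr rfl fun i _ => ?_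
    simp [Matrix.one_apply, shift, endVertex]
  | succ d ih =>
    have : Fintype (ShiftIndex s t b d) := Fintype.ofFinite _
    let f (x : Σ x : ShiftIndex s t b d, {e // s e = shift s t b d x}) : ShiftIndex s t b (d + 1) :=
      ⟨(x.1.1.1, x.2.1 :: x.1.1.2), ⟨x.2.2, x.1.2.1⟩, congrArg (· + 1) x.1.2.2⟩
    have h : Bijective f := by
      constructor
      · rintro ⟨⟨⟨i, p⟩, h⟩, e, he⟩ ⟨⟨⟨i', p'⟩, h'⟩, e', he'⟩ hxy
        simp only [f, Subtype.mk.injEq, Prod.mk.injEq, List.cons.injEq] at hxy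
        obtain ⟨rfl, rfl, rfl⟩ := hxy
        rfl
      · rintro ⟨⟨i, p⟩, h, h'⟩
        cases p with
        | nil => simp at h'
        | cons a p => exact ⟨⟨⟨(i, p), h.2, Nat.succ_injective h'⟩, ⟨a, h.1⟩⟩, rfl⟩
    rw [← h.sum_comp, Fintype.sum_sigma]
    have h1 (x : ShiftIndex s t b d) : ∑ e, g (shift s t b (d + 1) (f ⟨x, e⟩)) =
        ∑ w, intAdj s t (shift s t b d x) w • g w := sum_source_eq g _
    simp only [h1]
    rw [ih fun v => ∑ w, intAdj s t v w • g w]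
    refine Finset.sum_congr rfl fun i _ => ?_
    simp only [pow_succ, Matrix.mul_apply, Finset.smul_sum, Finset.sum_smul, smul_smul]
    exact Finset.sum_comm

omit [Fintype E] in
lemma exists_vecMul_pow_eq_zero
    (hdet : ((adjMatrix V E s t).map (fun n : ℕ => (n : ℚ))).det = 0) {r : ℕ} (hr : 0 < r) :
    ∃ c : V → ℤ, c ≠ 0 ∧ ∀ w, ∑ v, c v * (intAdj s t ^ r) v w = 0 := by
  have h : (intAdj s t).det = 0 := by
    have h1 := RingHom.map_det (Int.castRingHom ℚ) (intAdj s t)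
    have h2 : (Int.castRingHom ℚ).mapMatrix (intAdj s t) =
        (adjMatrix V E s t).map (fun n : ℕ => (n : ℚ)) := by
      ext i j
      simp [intAdj]
    rw [h2, hdet] at h1
    simpa using h1
  obtain ⟨c, hc, h0⟩ := Matrix.exists_vecMul_eq_zero_iff.2
    (show (intAdj s t ^ r).det = 0 by rw [Matrix.det_pow, h, zero_pow hr.ne'])
  exact ⟨c, hc, fun w => congrFun h0 w⟩

end Counting

section Closure

lemma mem_of_isSummand {S : Type u} [Ring S] {D : Set (FGMod S)} (hD : D = addOf D)
    {X Y : FGMod S} (hX : X ∈ D) (h : IsSummand Y X) : Y ∈ D := by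
  obtain ⟨i, p, h⟩ := exists_section_of_isSummand h
  rw [hD]
  exact mem_addOf_of_summand hX i p h

lemma mem_of_equiv {S : Type u} [Ring S] {D : Set (FGMod S)} (hD : D = addOf D)
    {X Y : FGMod S} (hX : X ∈ D) (e : X.carrier ≃ₗ[S] Y.carrier) : Y ∈ D :=
  mem_of_isSummand hD hX
    (isSummand_of_section e.symm.toLinearMap e.toLinearMap e.apply_symm_apply)

open PathMod

variable {k : Type u} [Field k] {V E : Type u} [Fintype V] [DecidableEq V] {s t : E → V} {m : ℕ}
  {D : Set (FGMod (TruncOp k s t m))}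

lemma vertexObj_mem_of_isPath [Finite E] (hD : D = addOf D) (hsyz : ∀ M ∈ D, syz M ∈ D) {r : ℕ}
    (hr : 0 < r) (hrm : r ≤ m) {v : V} (hv : vertexObj k s t m r v ∈ D) {p : List E}
    (hp : IsPath s t v p) (hpr : p.length = r) :
    vertexObj k s t m (m - r) (endVertex t v p) ∈ D := by
  obtain ⟨e⟩ := syz_equiv (isSyzygyOf_pathObj k s t m (fun _ : PUnit.{u + 1} => v) hr hrm)
  exact mem_of_isSummand hD (mem_of_equiv hD (hsyz _ hv) e.symm)
    (isSummand_vertexObj k s t m (shift s t (fun _ : PUnit.{u + 1} => v) r)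
      ⟨(PUnit.unit, p), hp, hpr⟩)

lemma vertexObj_mem_of_isPath_mul [Finite E] (hD : D = addOf D) (hsyz : ∀ M ∈ D, syz M ∈ D) {r : ℕ}
    (hr : 0 < r) (hrm : r < m) (n : ℕ) {v : V} (hv : vertexObj k s t m r v ∈ D) {p : List E}
    (hp : IsPath s t v p) (hpr : p.length = m * n) :
    vertexObj k s t m r (endVertex t v p) ∈ D := by
  induction n generalizing p with
  | zero =>
    obtain rfl := List.length_eq_zero_iff.1 hpr
    exact hv
  | succ n ih =>
    obtain ⟨q₁, q₂, q₃, rfl, h1, h2, h3⟩ : ∃ q₁ q₂ q₃ : List E, p = q₁ ++ (q₂ ++ q₃) ∧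
        q₁.length = m - r ∧ q₂.length = r ∧ q₃.length = m * n := by
      rw [mul_add_one] at hpr
      refine ⟨p.take (m - r), (p.drop (m - r)).take r, (p.drop (m - r)).drop r, ?_, ?_, ?_, ?_⟩
      · simp only [List.take_append_drop]
      all_goals simp only [List.length_take, List.length_drop]; omega
    rw [isPath_append, isPath_append, endVertex_append] at hp
    rw [endVertex_append, endVertex_append]
    have h4 := vertexObj_mem_of_isPath hD hsyz hr hrm.le (ih hp.2.2 h3) hp.2.1 h2
    have h5 := vertexObj_mem_of_isPath hD hsyz (Nat.sub_pos_of_lt hrm) (Nat.sub_le m r) h4 hp.1 h1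
    rwa [Nat.sub_sub_self hrm.le] at h5

/-- A submodule of `e J^d` which is not contained in `e J^(d+1)` has a summand
`e_w A / e_w J^(m-d)`. -/
lemma exists_section_of_coef_ne_zero {I : Type u} {b : I → V}
    (K : Submodule (TruncOp k s t m) (PathMod k s t m b m)) {d : ℕ} (hd : d ≤ m)
    (hK : ∀ z ∈ K, ∀ i p, p.length < d → coef k s t m b m i p z = 0)
    {z : PathMod k s t m b m} (hz : z ∈ K) {x : ShiftIndex s t b d}
    (hx : coef k s t m b m x.1.1 x.1.2 z ≠ 0) :
    ∃ (σ : VertexMod k s t m (m - d) (shift s t b d x) →ₗ[TruncOp k s t m] K)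
      (π : K →ₗ[TruncOp k s t m] VertexMod k s t m (m - d) (shift s t b d x)),
        ∀ x, π (σ x) = x := by
  have hrange (y : K) := (mem_range_shiftHom hd).2 (hK y y.2)
  let e : K.comap (shiftHom k s t m b d hd) ≃ₗ[TruncOp k s t m] K :=
    LinearEquiv.ofBijective ((shiftHom k s t m b d hd).restrict fun _ h => h)
      ⟨fun y z h => Subtype.ext (shiftHom_injective hd (congrArg Subtype.val h)), fun y => by
        obtain ⟨y', hy⟩ := hrange y
        exact ⟨⟨y', by rw [Submodule.mem_comap, hy]; exact y.2⟩, Subtype.ext hy⟩⟩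
  obtain ⟨z', rfl⟩ := hrange ⟨z, hz⟩
  have h1 := coef_shiftHom hd x [] z'
  rw [List.nil_append] at h1
  rw [h1] at hx
  obtain ⟨σ, π, h⟩ := exists_section_of_not_mem_rad (K.comap (shiftHom k s t m b d hd)) hz hx
  exact ⟨e.toLinearMap.comp σ, π.comp e.symm.toLinearMap, fun x => by simp [h]⟩

/-- A subcategory closed under syzygies and summands which contains a nonprojective module contains
some `e_w A / e_w J^r` with `0 < r < m`. -/
lemma exists_vertexObj_mem [Finite E] (hD : D = addOf D) (hsyz : ∀ M ∈ D, syz M ∈ D)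
    {M : FGMod (TruncOp k s t m)} (hM : M ∈ D) (hproj : ¬ M.IsProj) :
    Nonempty E ∧ ∃ w r, 0 < r ∧ r < m ∧ vertexObj k s t m r w ∈ D := by
  classical
  obtain ⟨I, _, b, f, hf, hker⟩ := exists_cover (k := k) (s := s) (t := t) (m := m) (r := m)
    (X := M.carrier) fun x p hp => by rw [arrowProd_of_length_eq k s t m hp, zero_smul]
  have hne : ∃ d, ∃ z ∈ LinearMap.ker f, ∃ i p, p.length = d ∧ coef k s t m b m i p z ≠ 0 := by
    by_contra! h
    have inj : Injective f := by
      rw [← LinearMap.ker_eq_bot, eq_bot_iff]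
      exact fun z hz => coef_ext fun i p => by rw [h _ z hz i p rfl, map_zero]
    exact hproj (Module.Projective.of_equiv (LinearEquiv.ofBijective f ⟨inj, hf⟩))
  obtain ⟨z, hz, i, p, hp, hzip⟩ := Nat.find_spec hne
  set d := Nat.find hne
  obtain ⟨hpath, -, hlt⟩ := isBasisPath_of_coef_ne_zero hzip
  rw [hp] at hlt
  have hp0 : p ≠ [] := by
    rintro rfl
    exact hzip (coef_nil_of_mem_rad (hker hz) i)
  obtain ⟨a, -⟩ := List.exists_mem_of_ne_nil p hp0
  have hd : 0 < d := by rw [← hp]; exact List.length_pos_of_ne_nil hp0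
  obtain ⟨σ, π, h⟩ := exists_section_of_coef_ne_zero (LinearMap.ker f) hlt.le
    (fun z hz i p hp => by_contra fun h => Nat.find_min hne hp ⟨z, hz, i, p, rfl, h⟩) hz
    (x := ⟨(i, p), hpath, hp⟩) hzip
  have hcover := isProjCover_of_ker_le_rad k s t m b f hf hker
  obtain ⟨e⟩ := syz_equiv (M := M) (N := ⟨LinearMap.ker f⟩)
    ⟨pathObj k s t m b m, f, hcover, ⟨.refl _ _⟩⟩
  refine ⟨⟨a⟩, _, m - d, by omega, by omega, mem_of_isSummand hD
    (mem_of_equiv (Y := ⟨LinearMap.ker f⟩) hD (hsyz M hM) e.symm)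
    (isSummand_of_section (X := vertexObj k s t m (m - d) _) (Y := ⟨LinearMap.ker f⟩) σ π h)⟩

/-- The modules `e_v A / e_v J^r`, for all `v`, do not lie in a common `0`-Igusa–Todorov
subcategory when the adjacency matrix is singular. -/
lemma not_forall_vertexObj_mem [Fintype E] {L : AddMonoid.End (K0 (TruncOp k s t m))}
    (hL : IsSyzEnd L) (hD : IsZeroIT L D) (hs : ∀ v, ∃ e, s e = v)
    (hdet : ((adjMatrix V E s t).map (fun n : ℕ => (n : ℚ))).det = 0) {r : ℕ} (hr : 0 < r)
    (hrm : r < m) : ¬ ∀ v, vertexObj k s t m r v ∈ D := by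
  intro hmem
  obtain ⟨hadd, hsyz, hphi⟩ := hD
  obtain ⟨c, hc, hc0⟩ := exists_vecMul_pow_eq_zero hdet hr
  have hP : pathObj k s t m (id : V → V) r ∈ D := by
    rw [hadd]
    exact pathObj_mem_addOf k s t m id hmem
  have hphi0 : phi L (pathObj k s t m (id : V → V) r) = 0 := by
    have h := (le_iSup₂ (f := fun (M : FGMod (TruncOp k s t m)) (_ : M ∈ D) => (phi L M : ℕ∞))
      _ hP).trans_eq hphi
    simpa using h
  have hinj := injOn_of_eta_eq_zero L (grpOf_pathObj_fg k s t m) hphi0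
  have hLv (v : V) : L (toK0 (vertexObj k s t m r v)) =
      ∑ w, (intAdj s t ^ r) v w • toK0 (vertexObj k s t m (m - r) w) := by
    obtain ⟨e⟩ := syz_equiv (isSyzygyOf_pathObj k s t m (fun _ : PUnit.{u + 1} => v) hr hrm.le)
    have : Fintype (ShiftIndex s t (fun _ : PUnit.{u + 1} => v) r) := Fintype.ofFinite _
    rw [hL, ← toK0_congr e, toK0_pathObj,
      sum_shift _ _ fun w => toK0 (vertexObj k s t m (m - r) w)]
    simp
  have hy : ∑ v, c v • toK0 (vertexObj k s t m r v) = 0 := by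
    refine hinj ?_ (zero_mem _) ?_
    · rw [grpOf_pathObj]
      exact sum_mem fun v _ => zsmul_mem (AddSubgroup.subset_closure (Set.mem_range_self v)) _
    · rw [map_zero, map_sum]
      simp only [map_zsmul, hLv, Finset.smul_sum, smul_smul]
      rw [Finset.sum_comm]
      simp only [← Finset.sum_smul, hc0, zero_smul, Finset.sum_const_zero]
  exact hc (funext (toK0_vertexObj_independent (fun v => exists_isPath_length hs v r) hr hrm hy))

end Closure

/-!
STATEMENT 17 (Proposition).  The following algebras have only trivial
`0`-Igusa-Todorov subcategories:
(1) any non-selfinjective radical square zero algebra `kQ/J²` with `Q` strongly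
    connected and adjacency matrix not invertible (determinant `0` over `ℚ`);
(2) any truncated path algebra `kQ/J^m` (`m ≥ 2`) with `Q` strongly connected,
    having at least one loop, and adjacency matrix not invertible.
-/
theorem stmt_17 (k V E : Type u) [Field k] [Fintype V] [DecidableEq V] [Nonempty V]
    [Fintype E] (s t : E → V)
    (hsc : StronglyConnected V E s t)
    (hdet : ((adjMatrix V E s t).map (fun n : ℕ => (n : ℚ))).det = 0) :
    (¬ Module.Injective (TruncPathAlg k V E s t 2)ᵐᵒᵖ (TruncPathAlg k V E s t 2) →
      OnlyTrivialZIT (TruncPathAlg k V E s t 2)ᵐᵒᵖ) ∧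
    (∀ m : ℕ, 2 ≤ m → (∃ e : E, s e = t e) →
      OnlyTrivialZIT (TruncPathAlg k V E s t m)ᵐᵒᵖ) := by
  constructor
  · intro _ L hL D hD M hM
    by_contra hproj
    obtain ⟨⟨e⟩, w, r, hr, hr2, hw⟩ := exists_vertexObj_mem hD.1 hD.2.1 hM hproj
    obtain rfl : r = 1 := by omega
    refine not_forall_vertexObj_mem hL hD (exists_source_eq hsc e) hdet hr hr2 fun v => ?_
    have h := hsc w v
    induction h with
    | refl => exact hw
    | tail _ he ih =>
      obtain ⟨e, rfl, rfl⟩ := he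
      exact vertexObj_mem_of_isPath hD.1 hD.2.1 one_pos one_le_two ih (p := [e])
        ⟨rfl, trivial⟩ rfl
  · rintro m hm ⟨e, he⟩ L hL D hD M hM
    by_contra hproj
    obtain ⟨-, w, r, hr, hrm, hw⟩ := exists_vertexObj_mem hD.1 hD.2.1 hM hproj
    refine not_forall_vertexObj_mem hL hD (exists_source_eq hsc e) hdet hr hrm fun v => ?_
    obtain ⟨n, p, hp, hpn, rfl⟩ := exists_isPath_length_mul hsc he (by omega : 0 < m) w v
    exact vertexObj_mem_of_isPath_mul hD.1 hD.2.1 hr hrm n hw hp hpn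

end LIT
end
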